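/- arXiv:math/0303302 — 6 statements merged into one kernel-verified Lean document; each statement's English description precedes it below -/
import Mathlib

section
/- Let n ≥ 1 and let w_0,…,w_n be rational numbers with w_i ≥ 2 for all i. Suppose f and g are polynomials in ℂ[z_0,…,z_n] that are both weighted homogeneous of type (w_0,…,w_n), and suppose that f and g each have an isolated singularity at the origin. Then the pairs (ℂ^{n+1}, V, 0) and (ℂ^{n+1}, W, 0), where V = f^{-1}(0) and W = g^{-1}(0), are homeomorphically equivalent: there exists a homeomorphism φ : ℂ^{n+1} → ℂ^{n+1} such that φ(0) = 0 and φ(V) = W. -/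
open MvPolynomial

/-- `f ∈ ℂ[z_0,…,z_{m-1}]` is weighted homogeneous of type `(w_0,…,w_{m-1})`:
every monomial `z^d` occurring in `f` satisfies `∑ i, d i / w i = 1`. -/
def IsWeightedHomogeneousOfType {m : ℕ} (w : Fin m → ℚ) (f : MvPolynomial (Fin m) ℂ) : Prop :=
  ∀ d ∈ f.support, (∑ i, (d i : ℚ) / w i) = 1

/-- `f` has an isolated singularity at the origin: there is `ε > 0` such that the origin
is the only point `z` with `‖z‖ < ε` at which `f` and all its first-order partial
derivatives vanish simultaneously. -/
def HasIsolatedSingularityAtOrigin {m : ℕ} (f : MvPolynomial (Fin m) ℂ) : Prop :=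
  ∃ ε > (0 : ℝ), ∀ z : Fin m → ℂ, ‖z‖ < ε →
    (eval z f = 0 ∧ ∀ i, eval z (pderiv i f) = 0) → z = 0

/-- `α` is an integral curve of the time-dependent vector field `X` on the unit time interval. -/
def IsUnitTimeSolution {E : Type*} [NormedAddCommGroup E] [NormedSpace ℝ E]
    (X : ℝ → E → E) (α : ℝ → E) : Prop :=
  ∀ t ∈ Set.Icc (0 : ℝ) 1, HasDerivWithinAt α (X t (α t)) (Set.Icc 0 1) t

namespace IsUnitTimeSolution

variable {E : Type*} [NormedAddCommGroup E] [NormedSpace ℝ E] {X : ℝ → E → E} {α β : ℝ → E}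

lemma continuousOn (h : IsUnitTimeSolution X α) : ContinuousOn α (Set.Icc 0 1) :=
  fun t ht => (h t ht).continuousWithinAt

lemma hasDerivWithinAt_Ici (h : IsUnitTimeSolution X α) {t : ℝ} (ht : t ∈ Set.Ico (0 : ℝ) 1) :
    HasDerivWithinAt α (X t (α t)) (Set.Ici t) t :=
  (h t ⟨ht.1, ht.2.le⟩).mono_of_mem_nhdsWithin (Icc_mem_nhdsGE_of_mem ht)

lemma dist_le {K : NNReal} (hX : ∀ t, LipschitzWith K (X t))
    (hα : IsUnitTimeSolution X α) (hβ : IsUnitTimeSolution X β) :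
    dist (α 1) (β 1) ≤ dist (α 0) (β 0) * Real.exp K := by
  simpa using dist_le_of_trajectories_ODE hX hα.continuousOn
    (fun t ht => hα.hasDerivWithinAt_Ici ht) hβ.continuousOn
    (fun t ht => hβ.hasDerivWithinAt_Ici ht) le_rfl 1 (by simp)

lemma comp_one_sub (h : IsUnitTimeSolution X α) :
    IsUnitTimeSolution (fun t z => -X (1 - t) z) (fun t => α (1 - t)) := by
  intro t ht
  have hm : Set.MapsTo (fun t : ℝ => 1 - t) (Set.Icc 0 1) (Set.Icc 0 1) :=
    fun s hs => ⟨by linarith [hs.2], by linarith [hs.1]⟩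
  have h1 : HasDerivWithinAt (fun t : ℝ => 1 - t) (-1) (Set.Icc 0 1) t := by
    simpa using (hasDerivWithinAt_id t _).const_sub (1 : ℝ)
  simpa [Function.comp_def] using (h (1 - t) (hm ht)).scomp t h1 hm

lemma exists_of_lipschitzWith [CompleteSpace E] {K L : NNReal} (hX : ∀ t, LipschitzWith K (X t))
    (hc : ∀ z, Continuous (X · z)) (hL : ∀ t z, ‖X t z‖ ≤ L) (z : E) :
    ∃ α, α 0 = z ∧ IsUnitTimeSolution X α := by
  have h : IsPicardLindelof X (tmin := 0) (tmax := 1) ⟨0, by simp⟩ z L 0 L K :=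
    { lipschitzOnWith := fun t _ => (hX t).lipschitzOnWith
      continuousOn := fun x _ => (hc x).continuousOn
      norm_le := fun t _ x _ => hL t x
      mul_max_le := by simp }
  exact h.exists_eq_forall_mem_Icc_hasDerivWithinAt₀

end IsUnitTimeSolution

/-- The time-one flow of a bounded, uniformly Lipschitz, time-dependent vector field is a
homeomorphism. -/
lemma exists_homeomorph_unit_time_flow {E : Type*} [NormedAddCommGroup E] [NormedSpace ℝ E]
    [CompleteSpace E] {X : ℝ → E → E} {K L : NNReal} (hX : ∀ t, LipschitzWith K (X t))
    (hc : ∀ z, Continuous (X · z)) (hL : ∀ t z, ‖X t z‖ ≤ L) :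
    ∃ φ : E ≃ₜ E, ∀ z, ∃ α, α 0 = z ∧ α 1 = φ z ∧ IsUnitTimeSolution X α := by
  have hX' : ∀ t, LipschitzWith K (fun z => -X (1 - t) z) := fun t => (hX (1 - t)).neg
  choose a ha0 ha using IsUnitTimeSolution.exists_of_lipschitzWith hX hc hL
  choose b hb0 hb using IsUnitTimeSolution.exists_of_lipschitzWith (X := fun t z => -X (1 - t) z)
    hX' (fun z => ((hc z).comp (continuous_const.sub continuous_id)).neg)
    (fun t z => by simpa using hL (1 - t) z)
  have hcont : ∀ {Y : ℝ → E → E} {c : E → ℝ → E}, (∀ t, LipschitzWith K (Y t)) →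
      (∀ z, c z 0 = z) → (∀ z, IsUnitTimeSolution Y (c z)) → Continuous (fun z => c z 1) := by
    intro Y c hY hc0 hc
    refine (LipschitzWith.of_dist_le_mul (K := (Real.exp K).toNNReal)
      fun x y => ?_).continuous
    rw [Real.coe_toNNReal _ (Real.exp_pos _).le]
    simpa [hc0, mul_comm] using (hc x).dist_le hY (hc y)
  refine ⟨⟨⟨fun z => a z 1, fun z => b z 1, fun z => ?_, fun z => ?_⟩,
    hcont hX ha0 ha, hcont hX' hb0 hb⟩, fun z => ⟨a z, ha0 z, rfl, ha z⟩⟩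
  · have := (hb (a z 1)).dist_le hX' (ha z).comp_one_sub
    simpa [hb0, ha0, dist_le_zero] using this
  · have h2 := (hb z).comp_one_sub
    simp only [neg_neg, sub_sub_cancel] at h2
    have := (ha (b z 1)).dist_le hX h2
    simpa [hb0, ha0, dist_le_zero] using this

/-- The weighted dilation of `ℂ^m` by a real factor. -/
noncomputable def weightedScale {m : ℕ} (A : Fin m → ℕ) (s : ℝ) (z : Fin m → ℂ) : Fin m → ℂ :=
  fun i => (s : ℂ) ^ A i * z i

/-- A real polynomial which is homogeneous under `weightedScale A` when `A i * B i` does not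
depend on `i`. -/
noncomputable def weightedNorm {m : ℕ} (B : Fin m → ℕ) (z : Fin m → ℂ) : ℝ :=
  ∑ i, Complex.normSq (z i) ^ B i

section Scale

variable {m : ℕ} {A B : Fin m → ℕ} {P : ℕ}

lemma weightedScale_weightedScale (s t : ℝ) (z : Fin m → ℂ) :
    weightedScale A s (weightedScale A t z) = weightedScale A (s * t) z := by
  ext i
  simp [weightedScale, mul_pow, mul_assoc]

@[simp]
lemma weightedScale_one (z : Fin m → ℂ) : weightedScale A 1 z = z := by
  ext i
  simp [weightedScale]

@[simp]
lemma weightedScale_zero_right (s : ℝ) : weightedScale A s 0 = 0 := by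
  ext i
  simp [weightedScale]

lemma continuous_weightedScale :
    Continuous fun p : ℝ × (Fin m → ℂ) => weightedScale A p.1 p.2 := by
  unfold weightedScale
  fun_prop

lemma eval_weightedScale {f : MvPolynomial (Fin m) ℂ} {D : ℕ} (hf : f.IsWeightedHomogeneous A D)
    (s : ℝ) (z : Fin m → ℂ) : eval (weightedScale A s z) f = (s : ℂ) ^ D * eval z f := by
  rw [eval_eq', eval_eq', Finset.mul_sum]
  refine Finset.sum_congr rfl fun e he => ?_
  have hD : ∑ i, A i * e i = D := by
    rw [← hf (mem_support_iff.1 he), Finsupp.weight_apply, Finsupp.sum_fintype _ _ (by simp)]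
    simp [mul_comm]
  simp only [weightedScale, mul_pow, Finset.prod_mul_distrib, ← pow_mul, Finset.prod_pow_eq_pow_sum,
    hD]
  ring

lemma weightedNorm_nonneg (z : Fin m → ℂ) : 0 ≤ weightedNorm B z :=
  Finset.sum_nonneg fun _ _ => pow_nonneg (Complex.normSq_nonneg _) _

lemma weightedNorm_pos {z : Fin m → ℂ} (hz : z ≠ 0) : 0 < weightedNorm B z := by
  obtain ⟨i, hi⟩ := Function.ne_iff.1 hz
  exact Finset.sum_pos' (fun _ _ => pow_nonneg (Complex.normSq_nonneg _) _)
    ⟨i, Finset.mem_univ _, pow_pos (Complex.normSq_pos.2 hi) _⟩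

lemma weightedNorm_zero (hB : ∀ i, 0 < B i) : weightedNorm B (0 : Fin m → ℂ) = 0 :=
  Finset.sum_eq_zero fun i _ => by simp [(hB i).ne']

lemma continuous_weightedNorm : Continuous (weightedNorm B) :=
  continuous_finsetSum _ fun i _ => (Complex.continuous_normSq.comp (continuous_apply i)).pow _

lemma weightedNorm_weightedScale (hAB : ∀ i, A i * B i = P) (s : ℝ) (z : Fin m → ℂ) :
    weightedNorm B (weightedScale A s z) = s ^ (2 * P) * weightedNorm B z := by
  rw [weightedNorm, weightedNorm, Finset.mul_sum]
  refine Finset.sum_congr rfl fun i _ => ?_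
  rw [weightedScale, map_mul, map_pow, Complex.normSq_ofReal, mul_pow, ← pow_mul, hAB, ← sq,
    ← pow_mul]

lemma norm_apply_le_one_of_weightedNorm_eq_one (hB : ∀ i, 0 < B i) {z : Fin m → ℂ}
    (hz : weightedNorm B z = 1) (i : Fin m) : ‖z i‖ ≤ 1 := by
  have h : Complex.normSq (z i) ^ B i ≤ 1 := hz ▸ Finset.single_le_sum
    (f := fun i => Complex.normSq (z i) ^ B i)
    (fun _ _ => pow_nonneg (Complex.normSq_nonneg _) _) (Finset.mem_univ i)
  rw [pow_le_one_iff_of_nonneg (Complex.normSq_nonneg _) (hB i).ne', Complex.normSq_eq_norm_sq,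
    sq_le_one_iff₀ (norm_nonneg _)] at h
  exact h

lemma isCompact_setOf_weightedNorm_eq_one (hB : ∀ i, 0 < B i) :
    IsCompact {z : Fin m → ℂ | weightedNorm B z = 1} := by
  refine (isCompact_closedBall (0 : Fin m → ℂ) 1).of_isClosed_subset
    (isClosed_eq continuous_weightedNorm continuous_const) fun z hz => ?_
  rw [mem_closedBall_zero_iff, pi_norm_le_iff_of_nonneg zero_le_one]
  exact norm_apply_le_one_of_weightedNorm_eq_one hB hz

/-- The scaling factor of a point relative to the hypersurface `weightedNorm B z = 1`. -/
noncomputable def weightedRadius (B : Fin m → ℕ) (P : ℕ) (z : Fin m → ℂ) : ℝ :=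
  weightedNorm B z ^ (((2 * P : ℕ) : ℝ)⁻¹)

lemma weightedRadius_pow (hP : 0 < P) (z : Fin m → ℂ) :
    weightedRadius B P z ^ (2 * P) = weightedNorm B z :=
  Real.rpow_inv_natCast_pow (weightedNorm_nonneg z) (by omega)

lemma weightedRadius_pos {z : Fin m → ℂ} (hz : z ≠ 0) : 0 < weightedRadius B P z :=
  Real.rpow_pos_of_pos (weightedNorm_pos hz) _

lemma weightedRadius_zero (hP : 0 < P) (hB : ∀ i, 0 < B i) :
    weightedRadius B P (0 : Fin m → ℂ) = 0 := by
  rw [weightedRadius, weightedNorm_zero hB, Real.zero_rpow]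
  exact inv_ne_zero (Nat.cast_ne_zero.2 (by omega))

lemma continuous_weightedRadius : Continuous (weightedRadius (m := m) B P) :=
  continuous_weightedNorm.rpow_const fun _ => Or.inr (inv_nonneg.2 (Nat.cast_nonneg _))

lemma weightedNorm_normalize (hAB : ∀ i, A i * B i = P) (hP : 0 < P) {z : Fin m → ℂ}
    (hz : z ≠ 0) : weightedNorm B (weightedScale A (weightedRadius B P z)⁻¹ z) = 1 := by
  rw [weightedNorm_weightedScale hAB, inv_pow, weightedRadius_pow hP,
    inv_mul_cancel₀ (weightedNorm_pos hz).ne']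

/-- The extension to `ℂ^m` of the restriction of `φ` to the hypersurface `weightedNorm B z = 1`,
equivariant under weighted dilations. -/
noncomputable def coneExtension (A B : Fin m → ℕ) (P : ℕ) (φ : (Fin m → ℂ) → (Fin m → ℂ))
    (z : Fin m → ℂ) : Fin m → ℂ :=
  weightedScale A (weightedRadius B P z) (φ (weightedScale A (weightedRadius B P z)⁻¹ z))

variable {φ ψ : (Fin m → ℂ) → (Fin m → ℂ)}

lemma coneExtension_zero (hA : ∀ i, 0 < A i) (hP : 0 < P) (hB : ∀ i, 0 < B i) :
    coneExtension A B P φ 0 = 0 := by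
  ext i
  simp [coneExtension, weightedScale, weightedRadius_zero hP hB, (hA i).ne']

lemma continuous_coneExtension (hA : ∀ i, 0 < A i) (hP : 0 < P) (hB : ∀ i, 0 < B i)
    (hAB : ∀ i, A i * B i = P) (hφ : Continuous φ)
    (hN : ∀ z, weightedNorm B (φ z) = weightedNorm B z) :
    Continuous (coneExtension A B P φ) := by
  rw [continuous_iff_continuousAt]
  intro z
  by_cases hz : z = 0
  · subst hz
    refine tendsto_pi_nhds.2 fun i => ?_
    rw [coneExtension_zero hA hP hB, Pi.zero_apply]
    have hlim : Filter.Tendsto (fun z => weightedRadius B P z ^ A i)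
        (nhds (0 : Fin m → ℂ)) (nhds 0) := by
      have := ((continuous_weightedRadius (B := B) (P := P)).pow (A i)).tendsto (0 : Fin m → ℂ)
      simpa only [Pi.pow_def, weightedRadius_zero hP hB, zero_pow (hA i).ne'] using this
    refine squeeze_zero_norm (fun z => ?_) hlim
    by_cases hz : z = 0
    · simp [hz, coneExtension_zero hA hP hB, weightedRadius_zero hP hB]
    · have h1 := norm_apply_le_one_of_weightedNorm_eq_one hB
        ((hN _).trans (weightedNorm_normalize hAB hP hz)) i
      have h0 : 0 ≤ weightedRadius B P z := (weightedRadius_pos hz).le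
      rw [coneExtension, weightedScale, norm_mul, norm_pow, Complex.norm_real, Real.norm_eq_abs,
        abs_of_nonneg h0]
      exact mul_le_of_le_one_right (pow_nonneg h0 _) h1
  · have hr : ContinuousAt (weightedRadius B P) z := continuous_weightedRadius.continuousAt
    have h1 : ContinuousAt (fun z => weightedScale A (weightedRadius B P z)⁻¹ z) z :=
      (continuous_weightedScale (A := A)).continuousAt.comp
        (f := fun z => ((weightedRadius B P z)⁻¹, z))
        ((hr.inv₀ (weightedRadius_pos hz).ne').prodMk continuousAt_id)
    exact (continuous_weightedScale (A := A)).continuousAt.comp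
        (f := fun z => (weightedRadius B P z, φ (weightedScale A (weightedRadius B P z)⁻¹ z)))
        (hr.prodMk (hφ.continuousAt.comp h1))

lemma coneExtension_coneExtension (hA : ∀ i, 0 < A i) (hP : 0 < P) (hB : ∀ i, 0 < B i)
    (hAB : ∀ i, A i * B i = P) (hN : ∀ z, weightedNorm B (φ z) = weightedNorm B z)
    (hψ : ∀ z, ψ (φ z) = z) (z : Fin m → ℂ) :
    coneExtension A B P ψ (coneExtension A B P φ z) = z := by
  by_cases hz : z = 0
  · simp [hz, coneExtension_zero hA hP hB]
  have hr := (weightedRadius_pos (B := B) (P := P) hz).ne'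
  have h1 : weightedRadius B P (coneExtension A B P φ z) = weightedRadius B P z := by
    rw [weightedRadius, coneExtension, weightedNorm_weightedScale hAB, hN,
      weightedNorm_normalize hAB hP hz, weightedRadius_pow hP, mul_one, weightedRadius]
  rw [coneExtension, h1, coneExtension, weightedScale_weightedScale, inv_mul_cancel₀ hr,
    weightedScale_one, hψ, weightedScale_weightedScale, mul_inv_cancel₀ hr, weightedScale_one]

lemma eval_coneExtension_eq_zero_iff (hP : 0 < P) (hAB : ∀ i, A i * B i = P) {D : ℕ}
    {f g : MvPolynomial (Fin m) ℂ} (hf : f.IsWeightedHomogeneous A D)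
    (hg : g.IsWeightedHomogeneous A D)
    (hfg : ∀ z, weightedNorm B z = 1 → (eval z f = 0 ↔ eval (φ z) g = 0)) {z : Fin m → ℂ}
    (hz : z ≠ 0) : eval z f = 0 ↔ eval (coneExtension A B P φ z) g = 0 := by
  have hr := (weightedRadius_pos (B := B) (P := P) hz).ne'
  have h := hfg _ (weightedNorm_normalize hAB hP hz)
  rw [eval_weightedScale hf] at h
  rw [coneExtension, eval_weightedScale hg]
  simpa [hr] using h

end Scale

/-- Multiplication by a weighted homogeneous polynomial shifts weighted homogeneous components. -/
lemma weightedHomogeneousComponent_mul_right {m : ℕ} {A : Fin m → ℕ}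
    {p : MvPolynomial (Fin m) ℂ} {e : ℕ} (hp : p.IsWeightedHomogeneous A e) (d : ℕ)
    (q : MvPolynomial (Fin m) ℂ) :
    weightedHomogeneousComponent A (d + e) (q * p) = weightedHomogeneousComponent A d q * p := by
  induction q using MvPolynomial.induction_on' with
  | monomial u a =>
    have hu : (monomial u a).IsWeightedHomogeneous A (Finsupp.weight A u) :=
      isWeightedHomogeneous_monomial A u a rfl
    by_cases h : Finsupp.weight A u = d
    · subst h
      rw [(hu.mul hp).weightedHomogeneousComponent_same, hu.weightedHomogeneousComponent_same]
    · rw [(hu.mul hp).weightedHomogeneousComponent_ne _ (by omega),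
        hu.weightedHomogeneousComponent_ne _ (Ne.symm h), zero_mul]
  | add p q ihp ihq => rw [add_mul, map_add, map_add, ihp, ihq, add_mul]

/-- The origin is the only possible critical point of `f`. -/
def HasOnlyTrivialCriticalPoint {m : ℕ} (f : MvPolynomial (Fin m) ℂ) : Prop :=
  ∀ z, (∀ i, eval z (pderiv i f) = 0) → z = 0

lemma HasOnlyTrivialCriticalPoint.exists_X_pow_mem {m : ℕ} {f : MvPolynomial (Fin m) ℂ}
    (hf : HasOnlyTrivialCriticalPoint f) :
    ∃ K : ℕ, ∀ i, (X i : MvPolynomial (Fin m) ℂ) ^ K ∈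
      Ideal.span (Set.range fun j => pderiv j f) := by
  set I := Ideal.span (Set.range fun j => pderiv j f)
  have h : ∀ i, ∃ K : ℕ, (X i : MvPolynomial (Fin m) ℂ) ^ K ∈ I := by
    intro i
    suffices (X i : MvPolynomial (Fin m) ℂ) ∈ I.radical from this
    rw [← vanishingIdeal_zeroLocus_eq_radical (K := ℂ) I, mem_vanishingIdeal_iff]
    intro z hz
    have : z = 0 := hf z fun j => by
      simpa [aeval_eq_eval] using hz _ (Ideal.subset_span ⟨j, rfl⟩)
    simp [this]
  choose K hK using h
  exact ⟨∑ i, K i, fun i => I.pow_mem_of_pow_mem (hK i)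
    (Finset.single_le_sum (f := K) (fun _ _ => Nat.zero_le _) (Finset.mem_univ i))⟩

lemma monomial_mem_of_weight_gt {m : ℕ} {A : Fin m → ℕ} {K : ℕ}
    {I : Ideal (MvPolynomial (Fin m) ℂ)} (hK : ∀ i, (X i : MvPolynomial (Fin m) ℂ) ^ K ∈ I)
    {e : Fin m →₀ ℕ} (he : K * ∑ i, A i < Finsupp.weight A e) : monomial e (1 : ℂ) ∈ I := by
  obtain ⟨i, hi⟩ : ∃ i, K ≤ e i := by
    by_contra! h
    refine he.not_ge ?_
    rw [Finsupp.weight_apply, Finsupp.sum_fintype _ _ (by simp), Finset.mul_sum]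
    exact Finset.sum_le_sum fun i _ => Nat.mul_le_mul_right _ (h i).le
  have : monomial e (1 : ℂ) = monomial (e - Finsupp.single i K) 1 * X i ^ K := by
    rw [X_pow_eq_monomial, monomial_mul, one_mul,
      tsub_add_cancel_of_le (Finsupp.single_le_iff.2 hi)]
  rw [this]
  exact I.mul_mem_left _ (hK i)

lemma exists_isWeightedHomogeneous_sum_mul_eq {m : ℕ} {A c : Fin m → ℕ} {d : ℕ}
    {p : Fin m → MvPolynomial (Fin m) ℂ} {e : Fin m → ℕ}
    (hp : ∀ j, (p j).IsWeightedHomogeneous A (e j)) (hce : ∀ j, c j + e j = d)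
    {q : MvPolynomial (Fin m) ℂ} (hq : q.IsWeightedHomogeneous A d)
    (hqp : q ∈ Ideal.span (Set.range p)) :
    ∃ H : Fin m → MvPolynomial (Fin m) ℂ,
      (∀ j, (H j).IsWeightedHomogeneous A (c j)) ∧ ∑ j, H j * p j = q := by
  obtain ⟨b, hb⟩ := Ideal.mem_span_range_iff_exists_fun.1 hqp
  refine ⟨fun j => weightedHomogeneousComponent A (c j) (b j),
    fun j => weightedHomogeneousComponent_isWeightedHomogeneous (c j) (b j), ?_⟩
  rw [← hq.weightedHomogeneousComponent_same, ← hb, map_sum]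
  refine Finset.sum_congr rfl fun j _ => ?_
  rw [← weightedHomogeneousComponent_mul_right (hp j), hce]

lemma Matrix.finite_setOf_det_one_add_smul_eq_zero {ι : Type*} [Fintype ι] [DecidableEq ι]
    (R : Matrix ι ι ℂ) : {t : ℂ | (1 + t • R).det = 0}.Finite := by
  let p : Polynomial ℂ := (1 + (Polynomial.X : Polynomial ℂ) • R.map Polynomial.C).det
  have hp : ∀ t, p.eval t = (1 + t • R).det := by
    intro t
    rw [← Polynomial.coe_evalRingHom, RingHom.map_det]
    congr 1
    ext i j
    simp [Matrix.one_apply, apply_ite, mul_comm t]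
  have hp0 : p ≠ 0 := fun h => by simpa [h] using hp 0
  refine (Polynomial.finite_setOfPred_isRoot hp0).subset fun t ht => ?_
  simpa [hp] using ht

lemma eval_eq_sum_of_isWeightedHomogeneous {m : ℕ} {A : Fin m → ℕ} {d : ℕ}
    {s : Finset (Fin m →₀ ℕ)} (hs : ∀ e, Finsupp.weight A e = d → e ∈ s)
    {q : MvPolynomial (Fin m) ℂ} (hq : q.IsWeightedHomogeneous A d) (z : Fin m → ℂ) :
    eval z q = ∑ e ∈ s, coeff e q * eval z (monomial e (1 : ℂ)) := by
  rw [eval_eq, Finset.sum_subset (s₂ := s)]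
  · refine Finset.sum_congr rfl fun e _ => ?_
    rw [eval_monomial, one_mul, Finsupp.prod]
  · exact fun e he => hs e (hq (mem_support_iff.1 he))
  · simp +contextual

/-- In a pencil of weighted homogeneous polynomials, having only the trivial critical point is
an open condition for the Zariski topology. -/
lemma finite_setOf_not_hasOnlyTrivialCriticalPoint {m : ℕ} {A : Fin m → ℕ} (hA : ∀ i, 0 < A i)
    {D : ℕ} (hAD : ∀ i, A i ≤ D) {f h : MvPolynomial (Fin m) ℂ}
    (hf : f.IsWeightedHomogeneous A D) (hh : h.IsWeightedHomogeneous A D)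
    (hcrit : HasOnlyTrivialCriticalPoint f) :
    {t : ℂ | ¬ HasOnlyTrivialCriticalPoint (f + C t * h)}.Finite := by
  classical
  obtain ⟨K, hK⟩ := hcrit.exists_X_pow_mem
  let d := (∏ i, A i) * (K * ∑ i, A i + D + 1)
  have hd : K * ∑ i, A i + D < d :=
    (Nat.lt_succ_self _).trans_le (Nat.le_mul_of_pos_left _ (Finset.prod_pos fun i _ => hA i))
  have hfin : {e : Fin m →₀ ℕ | Finsupp.weight A e = d}.Finite :=
    (Finsupp.finite_of_nat_weight_le A (fun i => (hA i).ne') d).subset fun e he => he.le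
  let M := hfin.toFinset
  have hM : ∀ e, e ∈ M ↔ Finsupp.weight A e = d := fun e => by simp [M]
  have hpf : ∀ {q : MvPolynomial (Fin m) ℂ}, q.IsWeightedHomogeneous A D → ∀ j,
      (pderiv j q).IsWeightedHomogeneous A (D - A j) :=
    fun hq j => hq.pderiv (Nat.sub_add_cancel (hAD j))
  have hH : ∀ e : M, ∃ H : Fin m → MvPolynomial (Fin m) ℂ,
      (∀ j, (H j).IsWeightedHomogeneous A (d - (D - A j))) ∧
        ∑ j, H j * pderiv j f = monomial e.1 1 := by
    intro e
    have he := (hM _).1 e.2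
    exact exists_isWeightedHomogeneous_sum_mul_eq (hpf hf) (fun j => by omega)
      (isWeightedHomogeneous_monomial A _ _ he) (monomial_mem_of_weight_gt (A := A) hK (by omega))
  choose H hH1 hH2 using hH
  let R : Matrix M M ℂ := fun e e' => coeff e'.1 (∑ j, H e j * pderiv j h)
  refine R.finite_setOf_det_one_add_smul_eq_zero.subset fun t ht => ?_
  simp only [HasOnlyTrivialCriticalPoint, not_forall, Set.mem_ofPred_eq] at ht
  obtain ⟨z, hz, hz0⟩ := ht
  obtain ⟨i, hi⟩ := Function.ne_iff.1 hz0
  refine Matrix.exists_mulVec_eq_zero_iff.1 ⟨fun e => eval z (monomial e.1 (1 : ℂ)), ?_, ?_⟩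
  · obtain ⟨k, hk⟩ : A i ∣ d :=
      (Finset.dvd_prod_of_mem A (Finset.mem_univ i)).trans (Dvd.intro _ rfl)
    have hkM : Finsupp.single i k ∈ M := by
      rw [hM, Finsupp.weight_single, hk, smul_eq_mul, mul_comm]
    refine Function.ne_iff.2 ⟨⟨_, hkM⟩, ?_⟩
    simpa [eval_monomial] using fun h0 => absurd h0 hi
  · ext e
    have h1 : eval z (∑ j, H e j * pderiv j h) =
        ∑ e' : M, R e e' * eval z (monomial e'.1 (1 : ℂ)) := by
      rw [eval_eq_sum_of_isWeightedHomogeneous (A := A) (d := d) (fun e he => (hM e).2 he),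
        ← Finset.sum_coe_sort]
      refine IsWeightedHomogeneous.sum _ _ _ fun j _ => ?_
      have := (hH1 e j).mul (hpf hh j)
      rwa [Nat.sub_add_cancel (by omega)] at this
    have h2 : eval z (monomial e.1 (1 : ℂ)) + t * eval z (∑ j, H e j * pderiv j h) = 0 := by
      rw [← hH2 e, map_sum, map_sum, Finset.mul_sum, ← Finset.sum_add_distrib]
      refine Finset.sum_eq_zero fun j _ => ?_
      have := hz j
      simp only [map_add, pderiv_C_mul, map_mul, eval_C] at this ⊢
      linear_combination eval z (H e j) * this
    rw [h1] at h2
    rw [Matrix.add_mulVec, Matrix.one_mulVec, Matrix.smul_mulVec]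
    exact h2

lemma hasDerivWithinAt_eval_comp {m : ℕ} {α : ℝ → Fin m → ℂ} {v : Fin m → ℂ} {s : Set ℝ} {t : ℝ}
    (hα : HasDerivWithinAt α v s t) (f : MvPolynomial (Fin m) ℂ) :
    HasDerivWithinAt (fun t => eval (α t) f) (∑ i, eval (α t) (pderiv i f) * v i) s t := by
  induction f using MvPolynomial.induction_on with
  | C a => simpa using hasDerivWithinAt_const t s a
  | add p q hp hq =>
    simpa [add_mul, Finset.sum_add_distrib] using hp.fun_add hq
  | mul_X p i hp =>
    have h := hp.fun_mul (hasDerivWithinAt_pi.1 hα i)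
    simp only [map_mul, eval_X]
    refine h.congr_deriv ?_
    simp only [pderiv_mul, map_add, map_mul, eval_X, pderiv_X, add_mul, Finset.sum_add_distrib,
      Finset.sum_mul]
    congr 1
    · exact Finset.sum_congr rfl fun j _ => by ring
    · simp [Pi.single_apply, apply_ite]

lemma contDiff_eval {m : ℕ} (f : MvPolynomial (Fin m) ℂ) :
    ContDiff ℝ 1 fun z : Fin m → ℂ => eval z f :=
  ((AnalyticOnNhd.eval_mvPolynomial f).contDiff (n := 1)).restrict_scalars ℝ

/-- The differential of `weightedNorm B` at `z` applied to `v`. -/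
noncomputable def weightedNormDeriv {m : ℕ} (B : Fin m → ℕ) (z v : Fin m → ℂ) : ℝ :=
  ∑ i, B i * Complex.normSq (z i) ^ (B i - 1) * (2 * inner ℝ (z i) (v i))

lemma hasDerivWithinAt_weightedNorm_comp {m : ℕ} (B : Fin m → ℕ) {α : ℝ → Fin m → ℂ}
    {v : Fin m → ℂ} {s : Set ℝ} {t : ℝ} (hα : HasDerivWithinAt α v s t) :
    HasDerivWithinAt (fun t => weightedNorm B (α t)) (weightedNormDeriv B (α t) v) s t := by
  simp only [weightedNorm, weightedNormDeriv, Complex.normSq_eq_norm_sq]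
  exact HasDerivWithinAt.fun_sum fun i _ => (hasDerivWithinAt_pi.1 hα i).norm_sq.pow (B i)

lemma weightedNormDeriv_sub_smul {m : ℕ} (B : Fin m → ℕ) (z u v : Fin m → ℂ) (c : ℝ) :
    weightedNormDeriv B z (u - c • v) = weightedNormDeriv B z u - c * weightedNormDeriv B z v := by
  simp only [weightedNormDeriv, Finset.mul_sum, ← Finset.sum_sub_distrib, Pi.sub_apply,
    Pi.smul_apply, inner_sub_right, real_inner_smul_right]
  exact Finset.sum_congr rfl fun i _ => by ring

lemma weightedNormDeriv_smul {m : ℕ} (B : Fin m → ℕ) (z u : Fin m → ℂ) (c : ℝ) :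
    weightedNormDeriv B z (c • u) = c * weightedNormDeriv B z u := by
  simp only [weightedNormDeriv, Finset.mul_sum, Pi.smul_apply, real_inner_smul_right]
  exact Finset.sum_congr rfl fun i _ => by ring

lemma weightedNormDeriv_euler {m : ℕ} {A B : Fin m → ℕ} {P : ℕ} (hB : ∀ i, 0 < B i)
    (hAB : ∀ i, A i * B i = P) (z : Fin m → ℂ) :
    weightedNormDeriv B z (fun i => A i * z i) = 2 * P * weightedNorm B z := by
  simp only [weightedNormDeriv, weightedNorm, Finset.mul_sum]
  refine Finset.sum_congr rfl fun i _ => ?_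
  have h1 : inner ℝ (z i) (A i * z i) = A i * Complex.normSq (z i) := by
    rw [← Complex.ofReal_natCast, ← Complex.real_smul, real_inner_smul_right,
      real_inner_self_eq_norm_sq, Complex.normSq_eq_norm_sq]
  rw [h1, ← hAB i, ← Nat.sub_add_cancel (hB i), pow_succ]
  push_cast [Nat.add_sub_cancel]
  ring

/-- Whether the solution of a linear scalar ODE vanishes does not depend on time. -/
lemma eq_zero_iff_of_hasDerivWithinAt_smul {F : ℝ → ℂ} {c : ℝ → ℝ} {M : ℝ}
    (hF : ∀ t ∈ Set.Icc (0 : ℝ) 1, HasDerivWithinAt F (c t • F t) (Set.Icc 0 1) t)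
    (hc : ∀ t ∈ Set.Icc (0 : ℝ) 1, |c t| ≤ M) : F 0 = 0 ↔ F 1 = 0 := by
  have key : ∀ {F : ℝ → ℂ} {c : ℝ → ℝ}, IsUnitTimeSolution (fun t y => c t • y) F →
      (∀ t ∈ Set.Icc (0 : ℝ) 1, |c t| ≤ M) → F 0 = 0 → F 1 = 0 := by
    intro F c hF hc h0
    refine eq_zero_of_abs_deriv_le_mul_abs_self_of_eq_zero_right (K := M) hF.continuousOn
      (fun t ht => hF.hasDerivWithinAt_Ici ht) h0 (fun t ht => ?_) 1 (by simp)
    rw [norm_smul]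
    exact mul_le_mul_of_nonneg_right (hc t (Set.Ico_subset_Icc_self ht)) (norm_nonneg _)
  refine ⟨key hF hc, fun h => ?_⟩
  have h1 := IsUnitTimeSolution.comp_one_sub (X := fun t y => c t • y) hF
  have := key (F := fun t => F (1 - t)) (c := fun t => -c (1 - t)) (by simpa using h1)
    (fun t ht => by simpa using hc (1 - t) ⟨by linarith [ht.2], by linarith [ht.1]⟩) (by simpa)
  simpa using this

lemma exists_contDiff_cutoff {E : Type*} [NormedAddCommGroup E] [NormedSpace ℝ E]
    [FiniteDimensional ℝ E] {C O : Set E} (hC : IsCompact C) (hO : IsOpen O) (hCO : C ⊆ O) :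
    ∃ χ : E → ℝ, ∃ T ⊆ O, ContDiff ℝ 1 χ ∧ IsCompact T ∧ (∀ x ∈ C, χ x = 1) ∧ ∀ x ∉ T, χ x = 0 := by
  obtain ⟨T, hT, hCT, hTO⟩ := exists_compact_between hC hO hCO
  obtain ⟨χ, h1, h0, -⟩ := exists_contMDiffMap_one_nhds_of_subset_interior (n := 1)
    (modelWithCornersSelf ℝ E) hC.isClosed hCT
  exact ⟨χ, T, hTO, χ.contMDiff.contDiff, hT, fun x hx => h1.self_of_nhdsSet x hx, h0⟩

/-- A `C¹` vector field defined near a compact set extends, after a cutoff, to one having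
a global flow. -/
lemma exists_homeomorph_of_contDiffOn {E : Type*} [NormedAddCommGroup E] [NormedSpace ℝ E]
    [FiniteDimensional ℝ E] {C O : Set (ℝ × E)} (hC : IsCompact C) (hO : IsOpen O) (hCO : C ⊆ O)
    {Y : ℝ × E → E} (hY : ContDiffOn ℝ 1 Y O) :
    ∃ χ : ℝ × E → ℝ, (∀ p ∈ C, χ p = 1) ∧ (∀ p ∉ O, χ p = 0) ∧
      ∃ φ : E ≃ₜ E, ∀ z, ∃ α, α 0 = z ∧ α 1 = φ z ∧
        IsUnitTimeSolution (fun t x => χ (t, x) • Y (t, x)) α := by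
  have := FiniteDimensional.complete ℝ E
  obtain ⟨χ, T, hTO, hχ, hT, h1, h0⟩ := exists_contDiff_cutoff hC hO hCO
  have hX : ContDiff ℝ 1 (fun p => χ p • Y p) := by
    rw [contDiff_iff_contDiffAt]
    intro p
    by_cases hp : p ∈ O
    · exact hχ.contDiffAt.smul (hY.contDiffAt (hO.mem_nhds hp))
    · refine contDiffAt_const (c := (0 : E)) |>.congr_of_eventuallyEq ?_
      filter_upwards [hT.isClosed.isOpen_compl.mem_nhds fun h => hp (hTO h)] with q hq
      rw [h0 q hq, zero_smul]
  have hsupp : HasCompactSupport (fun p => χ p • Y p) :=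
    HasCompactSupport.intro hT fun p hp => by rw [h0 p hp, zero_smul]
  obtain ⟨K, hK⟩ := hX.lipschitzWith_of_hasCompactSupport hsupp one_ne_zero
  obtain ⟨L, hL⟩ := hsupp.exists_bound_of_continuous hX.continuous
  refine ⟨χ, h1, fun p hp => h0 p fun h => hp (hTO h), ?_⟩
  refine exists_homeomorph_unit_time_flow (K := K) (L := L.toNNReal) (fun t => ?_) (fun z => ?_)
    (fun t z => (hL (t, z)).trans (Real.le_coe_toNNReal L))
  · simpa [Function.comp_def] using hK.comp (LipschitzWith.prodMk_left t)
  · exact hX.continuous.comp (Continuous.prodMk_left z)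

section Pencil

variable {m : ℕ}

/-- The gradient of `f + t * h` at `z`, as a function of `(t, z)`. -/
noncomputable def pencilGradient (f h : MvPolynomial (Fin m) ℂ) (p : ℝ × (Fin m → ℂ)) :
    Fin m → ℂ :=
  fun i => eval p.2 (pderiv i f) + p.1 * eval p.2 (pderiv i h)

/-- A vector field along which the family `f + t * h` is constant. -/
noncomputable def pencilLift (f h : MvPolynomial (Fin m) ℂ) (p : ℝ × (Fin m → ℂ)) : Fin m → ℂ :=
  fun i => (∑ j, ‖pencilGradient f h p j‖ ^ 2)⁻¹ • -(eval p.2 h * star (pencilGradient f h p i))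

/-- The coefficient of the Euler field which has to be subtracted from `pencilLift f h` in order to
make it tangent to the level sets of `weightedNorm B`. -/
noncomputable def pencilCorrection (B : Fin m → ℕ) (P : ℕ) (f h : MvPolynomial (Fin m) ℂ)
    (p : ℝ × (Fin m → ℂ)) : ℝ :=
  weightedNormDeriv B p.2 (pencilLift f h p) / (2 * P * weightedNorm B p.2)

/-- A vector field which is tangent to the level sets of `weightedNorm B` and along which the zero
locus of `f + t * h` is preserved. -/
noncomputable def pencilField (A B : Fin m → ℕ) (P : ℕ) (f h : MvPolynomial (Fin m) ℂ)
    (p : ℝ × (Fin m → ℂ)) : Fin m → ℂ :=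
  pencilLift f h p - pencilCorrection B P f h p • fun i => A i * p.2 i

variable {A B : Fin m → ℕ} {P D : ℕ} {f h : MvPolynomial (Fin m) ℂ} {p : ℝ × (Fin m → ℂ)}

lemma contDiff_eval_snd (f : MvPolynomial (Fin m) ℂ) :
    ContDiff ℝ 1 fun p : ℝ × (Fin m → ℂ) => eval p.2 f :=
  (contDiff_eval f).comp contDiff_snd

lemma contDiff_pencilGradient : ContDiff ℝ 1 (pencilGradient f h) :=
  contDiff_pi.2 fun _ => (contDiff_eval_snd _).add
    ((Complex.ofRealCLM.contDiff.comp contDiff_fst).mul (contDiff_eval_snd _))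

lemma sum_norm_sq_pos {v : Fin m → ℂ} (hv : v ≠ 0) : 0 < ∑ i, ‖v i‖ ^ 2 := by
  obtain ⟨i, hi⟩ := Function.ne_iff.1 hv
  exact Finset.sum_pos' (fun _ _ => sq_nonneg _)
    ⟨i, Finset.mem_univ _, pow_pos (norm_pos_iff.2 hi) _⟩

lemma contDiffAt_pencilLift (hp : pencilGradient f h p ≠ 0) :
    ContDiffAt ℝ 1 (pencilLift f h) p := by
  have hG : ∀ i, ContDiff ℝ 1 fun p => pencilGradient f h p i :=
    contDiff_pi.1 contDiff_pencilGradient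
  refine contDiffAt_pi.2 fun i => ContDiffAt.fun_smul ?_ ?_
  · exact (ContDiff.sum fun j _ => (hG j).norm_sq ℝ).contDiffAt.inv (sum_norm_sq_pos hp).ne'
  · exact ((contDiff_eval_snd h).mul (Complex.conjCLE.contDiff.comp (hG i))).neg.contDiffAt

lemma contDiff_weightedNorm : ContDiff ℝ 1 (weightedNorm (m := m) B) := by
  unfold weightedNorm
  simp only [Complex.normSq_eq_norm_sq]
  exact ContDiff.sum fun i _ => ((contDiff_apply ℝ ℂ i).norm_sq ℝ).pow _

lemma contDiffAt_pencilCorrection (hP : 0 < P) (hp : pencilGradient f h p ≠ 0) (hp0 : p.2 ≠ 0) :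
    ContDiffAt ℝ 1 (pencilCorrection B P f h) p := by
  have hi : ∀ i, ContDiff ℝ 1 fun p : ℝ × (Fin m → ℂ) => p.2 i :=
    fun i => (contDiff_apply ℝ ℂ i).comp contDiff_snd
  refine ContDiffAt.div ?_ ?_ ?_
  · unfold weightedNormDeriv
    simp only [Complex.normSq_eq_norm_sq]
    refine ContDiffAt.sum fun i _ => ContDiffAt.mul ?_ ?_
    · exact (contDiff_const.mul (((hi i).norm_sq ℝ).pow _)).contDiffAt
    · exact contDiffAt_const.mul
        ((hi i).contDiffAt.inner ℝ (contDiffAt_pi.1 (contDiffAt_pencilLift hp) i))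
  · exact contDiffAt_const.mul (contDiff_weightedNorm.comp contDiff_snd).contDiffAt
  · exact mul_ne_zero (by positivity) (weightedNorm_pos hp0).ne'

lemma contDiffAt_pencilField (hP : 0 < P) (hp : pencilGradient f h p ≠ 0) (hp0 : p.2 ≠ 0) :
    ContDiffAt ℝ 1 (pencilField A B P f h) p := by
  refine (contDiffAt_pencilLift hp).sub ((contDiffAt_pencilCorrection hP hp hp0).smul ?_)
  exact (contDiff_pi.2 fun i =>
    contDiff_const.mul ((contDiff_apply ℝ ℂ i).comp contDiff_snd)).contDiffAt

lemma weightedNormDeriv_pencilField (hP : 0 < P) (hB : ∀ i, 0 < B i) (hAB : ∀ i, A i * B i = P)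
    (hp0 : p.2 ≠ 0) : weightedNormDeriv B p.2 (pencilField A B P f h p) = 0 := by
  rw [pencilField, weightedNormDeriv_sub_smul, weightedNormDeriv_euler hB hAB, pencilCorrection,
    div_mul_cancel₀, sub_self]
  exact mul_ne_zero (by positivity) (weightedNorm_pos hp0).ne'

lemma sum_pencilGradient_mul_pencilLift (hp : pencilGradient f h p ≠ 0) :
    ∑ i, pencilGradient f h p i * pencilLift f h p i = -eval p.2 h := by
  have h0 : (((∑ j, ‖pencilGradient f h p j‖ ^ 2 : ℝ)) : ℂ) ≠ 0 :=
    Complex.ofReal_ne_zero.2 (sum_norm_sq_pos hp).ne'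
  have h1 : ∀ i, pencilGradient f h p i * pencilLift f h p i =
      -eval p.2 h * ((∑ j, ‖pencilGradient f h p j‖ ^ 2 : ℝ) : ℂ)⁻¹ *
        ((‖pencilGradient f h p i‖ ^ 2 : ℝ) : ℂ) := by
    intro i
    rw [pencilLift, Complex.real_smul, Complex.ofReal_inv, Complex.ofReal_pow, ← Complex.mul_conj',
      Complex.star_def]
    ring
  rw [Finset.sum_congr rfl fun i _ => h1 i, ← Finset.mul_sum, ← Complex.ofReal_sum,
    inv_mul_cancel_right₀ h0]

lemma eval_euler (hf : f.IsWeightedHomogeneous A D) (z : Fin m → ℂ) :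
    ∑ i, eval z (pderiv i f) * (A i * z i) = D * eval z f := by
  have := congr_arg (eval z) hf.sum_weight_X_mul_pderiv
  simp only [map_sum, map_mul, map_natCast, eval_X, nsmul_eq_mul] at this
  rw [← this]
  exact Finset.sum_congr rfl fun i _ => by ring

lemma sum_pencilGradient_mul_pencilField (hf : f.IsWeightedHomogeneous A D)
    (hh : h.IsWeightedHomogeneous A D) (hp : pencilGradient f h p ≠ 0) :
    ∑ i, pencilGradient f h p i * pencilField A B P f h p i =
      -eval p.2 h - pencilCorrection B P f h p * (D * (eval p.2 f + p.1 * eval p.2 h)) := by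
  have h2 : ∑ i, pencilGradient f h p i * (A i * p.2 i) =
      D * (eval p.2 f + p.1 * eval p.2 h) := by
    simp only [pencilGradient, add_mul, Finset.sum_add_distrib, mul_assoc, ← Finset.mul_sum,
      eval_euler hf, eval_euler hh]
    ring
  rw [← h2, ← sum_pencilGradient_mul_pencilLift hp, Finset.mul_sum, ← Finset.sum_sub_distrib]
  refine Finset.sum_congr rfl fun i _ => ?_
  simp only [pencilField, Pi.sub_apply, Pi.smul_apply, Complex.real_smul]
  ring

/-- If no member of the real segment from `f` to `f + h` has a nontrivial critical point, then the
zero loci of `f` and `f + h` are ambiently homeomorphic. -/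
lemma exists_homeomorph_of_segment (hA : ∀ i, 0 < A i) (hD : 0 < D)
    (hf : f.IsWeightedHomogeneous A D) (hh : h.IsWeightedHomogeneous A D)
    (hcrit : ∀ t ∈ Set.Icc (0 : ℝ) 1, HasOnlyTrivialCriticalPoint (f + C (t : ℂ) * h)) :
    ∃ φ : (Fin m → ℂ) ≃ₜ (Fin m → ℂ), φ 0 = 0 ∧ ∀ z, eval z f = 0 ↔ eval (φ z) (f + h) = 0 := by
  let P := ∏ i, A i
  have hP : 0 < P := Finset.prod_pos fun i _ => hA i
  choose B hAB' using fun i => Finset.dvd_prod_of_mem A (Finset.mem_univ i)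
  have hAB : ∀ i, A i * B i = P := fun i => (hAB' i).symm
  have hB : ∀ i, 0 < B i := fun i => Nat.pos_of_ne_zero fun h0 => hP.ne' (by simp [← hAB i, h0])
  let O : Set (ℝ × (Fin m → ℂ)) := {p | pencilGradient f h p ≠ 0 ∧ p.2 ≠ 0}
  let S : Set (ℝ × (Fin m → ℂ)) := Set.Icc 0 1 ×ˢ {z | weightedNorm B z = 1}
  have hO : IsOpen O := (isOpen_ne_fun contDiff_pencilGradient.continuous continuous_const).inter
    (isOpen_ne_fun continuous_snd continuous_const)
  have hS : IsCompact S := isCompact_Icc.prod (isCompact_setOf_weightedNorm_eq_one hB)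
  have hSO : S ⊆ O := by
    rintro ⟨t, z⟩ ⟨ht, hz⟩
    have hz0 : z ≠ 0 := by
      rintro rfl
      exact zero_ne_one ((weightedNorm_zero hB).symm.trans hz)
    refine ⟨fun h0 => hz0 (hcrit t ht z fun i => ?_), hz0⟩
    simpa [pencilGradient] using congr_fun h0 i
  obtain ⟨χ, hχ1, hχ0, φ, hφ⟩ := exists_homeomorph_of_contDiffOn hS hO hSO
    (Y := pencilField A B P f h) fun p hp =>
      (contDiffAt_pencilField hP hp.1 hp.2).contDiffWithinAt
  have hconst : ∀ {α : ℝ → Fin m → ℂ},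
      IsUnitTimeSolution (fun t x => χ (t, x) • pencilField A B P f h (t, x)) α →
      ∀ t ∈ Set.Icc (0 : ℝ) 1, weightedNorm B (α t) = weightedNorm B (α 0) := by
    intro α hα
    refine constant_of_has_deriv_right_zero
      (continuous_weightedNorm.comp_continuousOn hα.continuousOn) fun t ht => ?_
    refine (hasDerivWithinAt_weightedNorm_comp B (hα.hasDerivWithinAt_Ici ht)).congr_deriv ?_
    rw [weightedNormDeriv_smul]
    by_cases hp : (t, α t) ∈ O
    · rw [weightedNormDeriv_pencilField hP hB hAB hp.2, mul_zero]
    · rw [hχ0 _ hp, zero_mul]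
  have hN : ∀ z, weightedNorm B (φ z) = weightedNorm B z := by
    intro z
    obtain ⟨α, h0, h1, hα⟩ := hφ z
    rw [← h1, hconst hα 1 (by simp), h0]
  have hN' : ∀ z, weightedNorm B (φ.symm z) = weightedNorm B z := fun z => by
    rw [← hN, φ.apply_symm_apply]
  obtain ⟨M, hM⟩ := hS.exists_bound_of_continuousOn (f := pencilCorrection B P f h) fun p hp =>
    (contDiffAt_pencilCorrection hP (hSO hp).1 (hSO hp).2).continuousAt.continuousWithinAt
  have hzero : ∀ z, weightedNorm B z = 1 → (eval z f = 0 ↔ eval (φ z) (f + h) = 0) := by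
    intro z hz
    obtain ⟨α, h0, h1, hα⟩ := hφ z
    have hmem : ∀ t ∈ Set.Icc (0 : ℝ) 1, (t, α t) ∈ S :=
      fun t ht => ⟨ht, (hconst hα t ht).trans (h0 ▸ hz)⟩
    have key := eq_zero_iff_of_hasDerivWithinAt_smul (M := M * D)
      (F := fun t => eval (α t) f + t * eval (α t) h)
      (c := fun t => -(pencilCorrection B P f h (t, α t) * D)) (fun t ht => ?_) (fun t ht => ?_)
    · simpa [h0, h1] using key
    · have hd := hα t ht
      simp only [hχ1 _ (hmem t ht), one_smul] at hd
      have := (hasDerivWithinAt_eval_comp hd f).fun_add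
        (((hasDerivWithinAt_id t _).ofReal_comp).fun_mul (hasDerivWithinAt_eval_comp hd h))
      refine this.congr_deriv ?_
      have hs := sum_pencilGradient_mul_pencilField (B := B) (P := P) hf hh (hSO (hmem t ht)).1
      simp only [pencilGradient, add_mul, Finset.sum_add_distrib, mul_assoc,
        ← Finset.mul_sum] at hs
      simp only [id_eq, Complex.ofReal_one, one_mul, Complex.real_smul, Complex.ofReal_neg,
        Complex.ofReal_mul, Complex.ofReal_natCast]
      linear_combination hs
    · rw [abs_neg, abs_mul, Nat.abs_cast]
      exact mul_le_mul_of_nonneg_right (hM _ (hmem t ht)) (Nat.cast_nonneg _)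
  have hfh : (f + h).IsWeightedHomogeneous A D := hf.add hh
  refine ⟨⟨⟨coneExtension A B P φ, coneExtension A B P φ.symm,
    coneExtension_coneExtension hA hP hB hAB hN φ.symm_apply_apply,
    coneExtension_coneExtension hA hP hB hAB hN' φ.apply_symm_apply⟩,
    continuous_coneExtension hA hP hB hAB φ.continuous hN,
    continuous_coneExtension hA hP hB hAB φ.symm.continuous hN'⟩,
    coneExtension_zero hA hP hB, fun z => ?_⟩
  by_cases hz : z = 0
  · have h00 : ∀ {q : MvPolynomial (Fin m) ℂ}, q.IsWeightedHomogeneous A D → eval 0 q = 0 := by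
      intro q hq
      simpa [hD.ne'] using eval_weightedScale hq 0 0
    subst hz
    change _ ↔ eval (coneExtension A B P φ 0) (f + h) = 0
    rw [coneExtension_zero hA hP hB, h00 hf, h00 hfh]
  · exact eval_coneExtension_eq_zero_iff hP hAB hf hfh hzero hz

end Pencil

lemma HasIsolatedSingularityAtOrigin.hasOnlyTrivialCriticalPoint {m : ℕ} {A : Fin m → ℕ} {D : ℕ}
    {f : MvPolynomial (Fin m) ℂ} (hA : ∀ i, 0 < A i) (hAD : ∀ i, A i ≤ D) (hD : 0 < D)
    (hf : f.IsWeightedHomogeneous A D) (hfi : HasIsolatedSingularityAtOrigin f) :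
    HasOnlyTrivialCriticalPoint f := by
  obtain ⟨ε, hε, h⟩ := hfi
  intro z hz
  have hlim : Filter.Tendsto (fun s : ℝ => weightedScale A s z) (nhdsWithin 0 (Set.Ioi 0))
      (nhds 0) := by
    have := (continuous_weightedScale (A := A)).comp (Continuous.prodMk_left z)
    have h0 := this.tendsto 0
    have : weightedScale A 0 z = 0 := by
      ext i
      simp [weightedScale, (hA i).ne']
    simp only [Function.comp_apply, this] at h0
    exact h0.mono_left nhdsWithin_le_nhds
  obtain ⟨s, hs, hs0⟩ := ((hlim.eventually (Metric.ball_mem_nhds 0 hε)).and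
    self_mem_nhdsWithin).exists
  have hcrit : ∀ i, eval (weightedScale A s z) (pderiv i f) = 0 := fun i => by
    rw [eval_weightedScale (hf.pderiv (Nat.sub_add_cancel (hAD i))), hz i, mul_zero]
  have hzero : eval (weightedScale A s z) f = 0 := by
    have := eval_euler hf (weightedScale A s z)
    simpa [hcrit, hD.ne'] using this.symm
  have := h _ (mem_ball_zero_iff.1 hs) ⟨hzero, hcrit⟩
  rw [← weightedScale_one (A := A) z, ← inv_mul_cancel₀ (ne_of_gt hs0),
    ← weightedScale_weightedScale, this, weightedScale_zero_right]

/-- Clearing denominators turns rational weights into natural ones. -/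
lemma exists_natWeights {m : ℕ} {w : Fin m → ℚ} (hw : ∀ i, 1 ≤ w i) :
    ∃ (D : ℕ) (A : Fin m → ℕ), 0 < D ∧ (∀ i, 0 < A i) ∧ (∀ i, A i ≤ D) ∧
      ∀ f, IsWeightedHomogeneousOfType w f → f.IsWeightedHomogeneous A D := by
  have hw0 : ∀ i, 0 < w i := fun i => one_pos.trans_le (hw i)
  let D := ∏ i, (w i).num.natAbs
  have hnum : ∀ i, 0 < (w i).num.natAbs := fun i => Int.natAbs_pos.2 (Rat.num_pos.2 (hw0 i)).ne'
  have hD : 0 < D := Finset.prod_pos fun i _ => hnum i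
  choose c hc using fun i => Finset.dvd_prod_of_mem (fun i => (w i).num.natAbs) (Finset.mem_univ i)
  have hcpos : ∀ i, 0 < c i := fun i => Nat.pos_of_ne_zero fun h0 =>
    hD.ne' (by rw [show D = _ from hc i, h0, mul_zero])
  have hA : ∀ i, ((c i * (w i).den : ℕ) : ℚ) = D / w i := by
    intro i
    have h1 : (D : ℚ) = (w i).num * c i := by
      rw [show D = _ from hc i, Nat.cast_mul, Nat.cast_natAbs,
        abs_of_pos (Rat.num_pos.2 (hw0 i))]
    rw [eq_div_iff (hw0 i).ne', h1, Nat.cast_mul, mul_assoc, Rat.den_mul_eq_num, mul_comm]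
  refine ⟨D, fun i => c i * (w i).den, hD, fun i => Nat.mul_pos (hcpos i) (w i).den_pos,
    fun i => ?_, fun f hf d hd => ?_⟩
  · have : ((c i * (w i).den : ℕ) : ℚ) ≤ D := by
      rw [hA]
      exact div_le_self (Nat.cast_nonneg _) (hw i)
    exact_mod_cast this
  · have h1 := hf d (mem_support_iff.2 hd)
    have h2 : ((∑ i, d i * (c i * (w i).den) : ℕ) : ℚ) = D := by
      rw [Nat.cast_sum, ← mul_one (D : ℚ), ← h1, Finset.mul_sum]
      refine Finset.sum_congr rfl fun i _ => ?_
      rw [Nat.cast_mul, hA]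
      ring
    rw [Finsupp.weight_apply, Finsupp.sum_fintype _ _ (by simp)]
    simpa using (Nat.cast_injective h2 : _ = D)

/-- Two weighted homogeneous polynomials with the same weights and only the trivial critical point
have ambiently homeomorphic zero loci. -/
lemma exists_homeomorph_of_hasOnlyTrivialCriticalPoint {m : ℕ} {A : Fin m → ℕ} {D : ℕ}
    {f g : MvPolynomial (Fin m) ℂ} (hA : ∀ i, 0 < A i) (hAD : ∀ i, A i ≤ D) (hD : 0 < D)
    (hf : f.IsWeightedHomogeneous A D) (hg : g.IsWeightedHomogeneous A D)
    (hfc : HasOnlyTrivialCriticalPoint f) (hgc : HasOnlyTrivialCriticalPoint g) :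
    ∃ φ : (Fin m → ℂ) ≃ₜ (Fin m → ℂ), φ 0 = 0 ∧ ∀ z, eval z f = 0 ↔ eval (φ z) g = 0 := by
  let h := g - f
  have hC : ∀ (t : ℂ) {q : MvPolynomial (Fin m) ℂ}, q.IsWeightedHomogeneous A D →
      (C t * q).IsWeightedHomogeneous A D := fun t q hq => by
    simpa using (isWeightedHomogeneous_C A t).mul hq
  have hh : h.IsWeightedHomogeneous A D := by
    simpa [h, sub_eq_add_neg] using hg.add (hC (-1) hf)
  let G : Set ℂ := {t | ¬ HasOnlyTrivialCriticalPoint (f + C t * h)}ᶜ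
  have hfin := finite_setOf_not_hasOnlyTrivialCriticalPoint hA hAD hf hh hfc
  have hGo : IsOpen G := hfin.isClosed.isOpen_compl
  have hGc : IsPreconnected G := (hfin.countable.isConnected_compl_of_one_lt_rank
    (by rw [Complex.rank_real_complex]; norm_num)).isPreconnected
  have hmem : ∀ {t}, t ∈ G ↔ HasOnlyTrivialCriticalPoint (f + C t * h) := not_not
  have h0 : (0 : ℂ) ∈ G := hmem.2 (by simpa using hfc)
  have h1 : (1 : ℂ) ∈ G := hmem.2 (by simpa [h] using hgc)
  have key := hGc.induction₂ (fun x y => ∃ φ : (Fin m → ℂ) ≃ₜ (Fin m → ℂ), φ 0 = 0 ∧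
    ∀ z, eval z (f + C x * h) = 0 ↔ eval (φ z) (f + C y * h) = 0) ?_ ?_ ?_ h0 h1
  · simpa [h] using key
  · intro x hx
    obtain ⟨r, hr, hball⟩ := Metric.isOpen_iff.1 hGo x hx
    filter_upwards [nhdsWithin_le_nhds (Metric.ball_mem_nhds x hr)] with y hy
    have := exists_homeomorph_of_segment hA hD (hf.add (hC x hh)) (hC (y - x) hh) fun t ht => ?_
    · simpa [add_assoc, ← add_mul, ← C_add] using this
    · have hmt : x + t * (y - x) ∈ Metric.ball x r := by
        simpa using (convex_ball x r).add_smul_sub_mem (Metric.mem_ball_self hr) hy ht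
      have := hmem.1 (hball hmt)
      convert this using 1
      simp only [map_add, map_mul]
      ring
  · rintro x y z - - - ⟨φ, hφ0, hφ⟩ ⟨ψ, hψ0, hψ⟩
    exact ⟨φ.trans ψ, by simp [hφ0, hψ0], fun z => (hφ z).trans (hψ _)⟩
  · rintro x y - - ⟨φ, hφ0, hφ⟩
    refine ⟨φ.symm, by rw [← hφ0, φ.symm_apply_apply, hφ0], fun z => ?_⟩
    rw [hφ, φ.apply_symm_apply]

/-- **Theorem 2.4.** If `f` and `g` are weighted homogeneous polynomials of the same type
`(w_0,…,w_n)` with `w_i ≥ 2`, each with an isolated singularity at the origin, then the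
pairs `(ℂ^{n+1}, f⁻¹(0), 0)` and `(ℂ^{n+1}, g⁻¹(0), 0)` are homeomorphically equivalent. -/
theorem weighted_homogeneous_same_weights_same_topological_type
    (n : ℕ) (hn : 1 ≤ n) (w : Fin (n + 1) → ℚ) (hw : ∀ i, 2 ≤ w i)
    (f g : MvPolynomial (Fin (n + 1)) ℂ)
    (hf : IsWeightedHomogeneousOfType w f) (hg : IsWeightedHomogeneousOfType w g)
    (hfi : HasIsolatedSingularityAtOrigin f) (hgi : HasIsolatedSingularityAtOrigin g) :
    ∃ φ : (Fin (n + 1) → ℂ) ≃ₜ (Fin (n + 1) → ℂ),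
      φ 0 = 0 ∧ φ '' {z | eval z f = 0} = {z | eval z g = 0} := by
  obtain ⟨D, A, hD, hA, hAD, h⟩ := exists_natWeights fun i => one_le_two.trans (hw i)
  obtain ⟨φ, hφ0, hφ⟩ := exists_homeomorph_of_hasOnlyTrivialCriticalPoint hA hAD hD
    (h f hf) (h g hg) (hfi.hasOnlyTrivialCriticalPoint hA hAD hD (h f hf))
    (hgi.hasOnlyTrivialCriticalPoint hA hAD hD (h g hg))
  refine ⟨φ, hφ0, ?_⟩
  ext z
  rw [φ.image_eq_preimage_symm]
  simp [hφ]
end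

section
/- Fix rational numbers w_0,…,w_n with w_i ≥ 2 for all i, and suppose there exists a polynomial that is weighted homogeneous of type (w_0,…,w_n) and has an isolated singularity at the origin. Let ℂ[Δ] denote the finite-dimensional complex vector space of all polynomials in ℂ[z_0,…,z_n] that are weighted homogeneous of type (w_0,…,w_n), i.e., whose support is contained in the finite set of lattice points (d_0,…,d_n) ∈ ℤ_{≥0}^{n+1} with d_0/w_0 + ⋯ + d_n/w_n = 1. Then the set U = {f ∈ ℂ[Δ] : f has an isolated singularity at the origin} is a nonempty Zariski-open subset of ℂ[Δ]: U is nonempty, and there exist finitely many polynomial functions of the coefficients of f (with respect to the monomial basis of ℂ[Δ]) whose common zero locus is exactly the complement ℂ[Δ] ∖ U. -/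
open MvPolynomial

open Finsupp (weight)

section WeightedHomogeneous

variable {σ : Type*} [Fintype σ] {v : σ → ℚ} {f : MvPolynomial σ ℂ} {N : ℚ}

theorem weight_eq_sum (v : σ → ℚ) (d : σ →₀ ℕ) : weight v d = ∑ i, (d i : ℚ) * v i := by
  simp [Finsupp.weight_apply, Finsupp.sum_fintype]

/-- Weighted homogeneity, evaluated along the orbit of a one-parameter group of scalings. -/
theorem MvPolynomial.IsWeightedHomogeneous.eval_exp_mul (h : f.IsWeightedHomogeneous v N)
    (s : ℝ) (z : σ → ℂ) :
    eval (fun i => ((Real.exp (s * v i) : ℝ) : ℂ) * z i) f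
      = ((Real.exp (s * N) : ℝ) : ℂ) * eval z f := by
  rw [eval_eq', eval_eq', Finset.mul_sum]
  refine Finset.sum_congr rfl fun d hd => ?_
  have hN := h (mem_support_iff.mp hd)
  have hprod : ∏ i, (((Real.exp (s * v i) : ℝ) : ℂ)) ^ d i = ((Real.exp (s * N) : ℝ) : ℂ) := by
    rw [← hN, weight_eq_sum]
    push_cast
    rw [Finset.mul_sum, Complex.exp_sum]
    refine Finset.prod_congr rfl fun i _ => ?_
    rw [← Complex.exp_nat_mul]
    ring_nf
  simp_rw [mul_pow, Finset.prod_mul_distrib, hprod]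
  ring

/-- Euler's identity for rational weights. -/
theorem MvPolynomial.IsWeightedHomogeneous.sum_C_mul_X_mul_pderiv
    (h : f.IsWeightedHomogeneous v N) :
    ∑ i, C (v i : ℂ) * (X i * pderiv i f) = C (N : ℂ) * f := by
  classical
  ext d
  have hcoeff : ∀ i, coeff d (X i * pderiv i f) = d i * coeff d f := by
    intro i
    rw [coeff_X_mul']
    split_ifs with hi
    · have hle : Finsupp.single i 1 ≤ d := by
        rw [Finsupp.single_le_iff]
        exact Nat.one_le_iff_ne_zero.mpr (Finsupp.mem_support_iff.mp hi)
      rw [coeff_pderiv, tsub_add_cancel_of_le hle]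
      have : 1 ≤ d i := Finsupp.single_le_iff.mp hle
      simp [Nat.cast_sub this, mul_comm]
    · simp [Finsupp.notMem_support_iff.mp hi]
  simp only [coeff_sum, coeff_C_mul, hcoeff]
  by_cases hd : coeff d f = 0
  · simp [hd]
  · rw [← h hd, weight_eq_sum]
    push_cast
    rw [Finset.sum_mul]
    exact Finset.sum_congr rfl fun i _ => by ring

theorem MvPolynomial.IsWeightedHomogeneous.eval_eq_sum
    [Fintype {d : σ →₀ ℕ // weight v d = N}] (h : f.IsWeightedHomogeneous v N) (z : σ → ℂ) :
    eval z f = ∑ d : {d : σ →₀ ℕ // weight v d = N}, coeff d.1 f * ∏ i, z i ^ d.1 i := by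
  classical
  rw [eval_eq']
  refine Finset.sum_bij_ne_zero (fun d hd _ => ⟨d, h (mem_support_iff.mp hd)⟩)
    (fun _ _ _ => Finset.mem_univ _) (fun _ _ _ _ _ _ hd => congrArg Subtype.val hd)
    (fun d _ hd => ⟨d.1, mem_support_iff.mpr (left_ne_zero_of_mul hd), hd, rfl⟩)
    (fun _ _ _ => rfl)

theorem finite_weight_eq (hv : ∀ i, 0 < v i) (N : ℚ) :
    Finite {d : σ →₀ ℕ // weight v d = N} := by
  classical
  have hbox : (Set.Icc 0 (Finsupp.equivFunOnFinite.symm fun i => ⌊N / v i⌋₊) :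
      Set (σ →₀ ℕ)).Finite := Set.finite_Icc _ _
  refine (hbox.subset (t := {d : σ →₀ ℕ | weight v d = N}) fun d hd =>
    ⟨zero_le, fun i => ?_⟩).to_subtype
  have hd : weight v d = N := hd
  change d i ≤ ⌊N / v i⌋₊
  refine Nat.le_floor ?_
  rw [le_div_iff₀ (hv i), ← hd, weight_eq_sum]
  exact Finset.single_le_sum (f := fun i => (d i : ℚ) * v i)
    (fun j _ => mul_nonneg (Nat.cast_nonneg _) (hv j).le) (Finset.mem_univ i)

end WeightedHomogeneous

/-- A family of vectors on which no nonzero covector vanishes contains a square subfamily of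
nonzero determinant. -/
theorem Matrix.exists_det_ne_zero_of_forall_vecMul_eq_zero {K S T : Type*} [Field K] [Fintype S]
    [DecidableEq S] (A : Matrix S T K)
    (h : ∀ l : S → K, (∀ t, ∑ s, l s * A s t = 0) → l = 0) :
    ∃ c : S → T, (A.submatrix id c).det ≠ 0 := by
  have hspan : Submodule.span K (Set.range A.col) = ⊤ := by
    by_contra hne
    obtain ⟨φ, hφ, hle⟩ := Submodule.exists_le_ker_of_lt_top _ (lt_top_iff_ne_top.mpr hne)
    have hφ_apply : ∀ x, φ x = ∑ s, φ (Pi.single s 1) * x s := by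
      intro x
      conv_lhs => rw [pi_eq_sum_univ' x]
      simp [mul_comm]
    have hl := h (fun s => φ (Pi.single s 1)) fun t => by
      rw [← hφ_apply fun s => A s t]
      exact hle (Submodule.subset_span ⟨t, rfl⟩)
    refine hφ (LinearMap.ext fun x => ?_)
    rw [hφ_apply]
    exact Finset.sum_eq_zero fun s _ => by simpa using Or.inl (congrFun hl s)
  obtain ⟨b, hb, hbspan, hbli⟩ := exists_linearIndependent K (Set.range A.col)
  let B := Module.Basis.mk hbli (by simp [hbspan, hspan])
  let e : S ≃ b := (Pi.basisFun K S).indexEquiv B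
  choose c hc using fun s => hb (e s).2
  refine ⟨c, ?_⟩
  have hcol : LinearIndependent K (A.submatrix id c).col := by
    have : (A.submatrix id c).col = (fun x : b => (x : S → K)) ∘ e := funext fun s => hc s
    rw [this]
    exact hbli.comp e e.injective
  rw [Matrix.linearIndependent_cols_iff_isUnit, Matrix.isUnit_iff_isUnit_det] at hcol
  exact hcol.ne_zero

/-- The common zero locus of an arbitrary set of polynomials in finitely many variables is cut
out by finitely many polynomials. -/
theorem MvPolynomial.exists_fin_forall_eval_eq_zero_iff {K τ : Type*} [Field K] [Finite τ]
    (s : Set (MvPolynomial τ K)) :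
    ∃ (k : ℕ) (P : Fin k → MvPolynomial τ K),
      ∀ x, (∀ j, eval x (P j) = 0) ↔ ∀ p ∈ s, eval x p = 0 := by
  obtain ⟨k, P, hP⟩ := Submodule.fg_iff_exists_fin_generating_family.mp
    (IsNoetherian.noetherian (Ideal.span s))
  refine ⟨k, P, fun x => ?_⟩
  have hker : ∀ t : Set (MvPolynomial τ K),
      (∀ p ∈ t, eval x p = 0) ↔ Ideal.span t ≤ RingHom.ker (eval x) :=
    fun t => (Ideal.span_le (I := RingHom.ker (eval x))).symm
  rw [hker, ← hP, ← Set.forall_mem_range (p := fun p => eval x p = 0), hker]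

section Jacobian

variable {m : ℕ} {v : Fin m → ℚ} {f : MvPolynomial (Fin m) ℂ}

/-- By scaling, an isolated singularity of a weighted homogeneous polynomial is its only
critical point. -/
theorem MvPolynomial.IsWeightedHomogeneous.hasIsolatedSingularityAtOrigin_iff
    (h : f.IsWeightedHomogeneous v 1) (hv : ∀ i, 0 < v i) :
    HasIsolatedSingularityAtOrigin f ↔
      ∀ z : Fin m → ℂ, (∀ i, eval z (pderiv i f) = 0) → z = 0 := by
  refine ⟨fun ⟨ε, hε, hz⟩ z hcrit => ?_, fun hz => ⟨1, one_pos, fun z _ hcrit => hz z hcrit.2⟩⟩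
  have hzero : eval z f = 0 := by
    have := congrArg (eval z) h.sum_C_mul_X_mul_pderiv
    simpa [hcrit] using this.symm
  let φ : ℝ → Fin m → ℂ := fun s i => ((Real.exp (s * v i) : ℝ) : ℂ) * z i
  have hlim : Filter.Tendsto φ Filter.atBot (nhds 0) := by
    refine tendsto_pi_nhds.mpr fun i => ?_
    have hexp : Filter.Tendsto (fun s : ℝ => Real.exp (s * v i)) Filter.atBot (nhds 0) :=
      Real.tendsto_exp_atBot.comp
        (Filter.tendsto_id.atBot_mul_const (by exact_mod_cast hv i))
    have := ((Complex.continuous_ofReal.tendsto 0).comp hexp).mul_const (z i)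
    simpa [φ] using this
  obtain ⟨s, hs⟩ := (hlim.eventually (Metric.ball_mem_nhds 0 hε)).exists
  have hφ : φ s = 0 := by
    refine hz (φ s) (by simpa using hs) ⟨?_, fun i => ?_⟩
    · rw [h.eval_exp_mul, hzero, mul_zero]
    · rw [(h.pderiv (i := i) (sub_add_cancel 1 (v i))).eval_exp_mul, hcrit, mul_zero]
  funext i
  simpa [φ, Real.exp_ne_zero] using congrFun hφ i

/-- The matrix of `(g_i) ↦ ∑ g_i ∂f/∂z_i`, from tuples of monomials to weighted degree `D`. -/
noncomputable def jacobianMatrix {R : Type*} [CommRing R] (v : Fin m → ℚ) (D : ℚ)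
    (f : MvPolynomial (Fin m) R) :
    Matrix {e : Fin m →₀ ℕ // weight v e = D}
      (Σ i, {e : Fin m →₀ ℕ // weight v e + (1 - v i) = D}) R :=
  fun e t => coeff e.1 (monomial t.2.1 1 * pderiv t.1 f)

theorem jacobianMatrix_map {R R' : Type*} [CommRing R] [CommRing R'] (φ : R →+* R')
    (D : ℚ) (f : MvPolynomial (Fin m) R) :
    jacobianMatrix v D (map φ f) = (jacobianMatrix v D f).map φ := by
  ext e t
  simp [jacobianMatrix, pderiv_map, ← coeff_map]

/-- A nonzero maximal minor in a degree containing pure powers of all variables rules out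
critical points other than the origin. -/
theorem eq_zero_of_det_jacobianMatrix_ne_zero (h : f.IsWeightedHomogeneous v 1) {D : ℚ}
    [Fintype {e : Fin m →₀ ℕ // weight v e = D}]
    (hD : ∀ i, ∃ N : ℕ, N * v i = D)
    {c : {e : Fin m →₀ ℕ // weight v e = D} →
      Σ i, {e : Fin m →₀ ℕ // weight v e + (1 - v i) = D}}
    (hc : ((jacobianMatrix v D f).submatrix id c).det ≠ 0)
    {z : Fin m → ℂ} (hz : ∀ i, eval z (pderiv i f) = 0) : z = 0 := by
  have hker : (fun e : {e : Fin m →₀ ℕ // weight v e = D} => ∏ i, z i ^ e.1 i) = 0 := by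
    by_contra hne
    refine hc (Matrix.exists_vecMul_eq_zero_iff.mp ⟨_, hne, funext fun s => ?_⟩)
    rw [Matrix.vecMul, dotProduct]
    have hmul := (isWeightedHomogeneous_monomial v (c s).2.1 (1 : ℂ) rfl).mul
      (h.pderiv (i := (c s).1) (sub_add_cancel 1 (v (c s).1)))
    rw [(c s).2.2] at hmul
    have heval := hmul.eval_eq_sum z
    rw [map_mul, hz, mul_zero] at heval
    rw [Pi.zero_apply, heval]
    exact Finset.sum_congr rfl fun e _ => mul_comm _ _
  funext i
  obtain ⟨N, hN⟩ := hD i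
  have hi := congrFun hker ⟨Finsupp.single i N, by simpa [Finsupp.weight_apply] using hN⟩
  rw [Pi.zero_apply, Finset.prod_eq_single i (by intros; simp_all [Finsupp.single_apply])
    (by simp)] at hi
  exact eq_zero_of_pow_eq_zero hi

/-- By the Nullstellensatz, if the origin is the only critical point, then the Jacobian ideal
contains all monomials of sufficiently large weighted degree. -/
theorem exists_forall_monomial_mem_span_pderiv
    (hv : ∀ i, 0 < v i) (hz : ∀ z : Fin m → ℂ, (∀ i, eval z (pderiv i f) = 0) → z = 0) :
    ∃ B : ℚ, ∀ e : Fin m →₀ ℕ, B < weight v e →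
      monomial e 1 ∈ Ideal.span (Set.range fun i => pderiv i f) := by
  have hX : ∀ i, ∃ N : ℕ, X i ^ N ∈ Ideal.span (Set.range fun i => pderiv i f) := by
    intro i
    change X i ∈ (Ideal.span (Set.range fun i => pderiv i f)).radical
    rw [← vanishingIdeal_zeroLocus_eq_radical (K := ℂ), mem_vanishingIdeal_iff, zeroLocus_span]
    intro z hzero
    have : z = 0 := hz z fun i => by
      simpa [aeval_eq_eval] using hzero _ ⟨i, rfl⟩
    simp [this]
  choose N hN using hX
  refine ⟨∑ i, N i * v i, fun e he => ?_⟩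
  rw [weight_eq_sum] at he
  obtain ⟨i, -, hi⟩ := Finset.exists_lt_of_sum_lt he
  have hle : Finsupp.single i (N i) ≤ e :=
    Finsupp.single_le_iff.mpr (by exact_mod_cast (lt_of_mul_lt_mul_right hi (hv i).le).le)
  have hmul : (monomial e 1 : MvPolynomial (Fin m) ℂ)
      = monomial (e - Finsupp.single i (N i)) 1 * X i ^ N i := by
    rw [X_pow_eq_monomial, monomial_mul, tsub_add_cancel_of_le hle, one_mul]
  rw [hmul]
  exact Ideal.mul_mem_left _ _ (hN i)

/-- If the Jacobian ideal contains all monomials of weighted degree `D`, then some maximal minor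
of the Jacobian matrix in that degree is nonzero. -/
theorem exists_det_jacobianMatrix_ne_zero (h : f.IsWeightedHomogeneous v 1) {D : ℚ}
    [Fintype {e : Fin m →₀ ℕ // weight v e = D}]
    (hD : ∀ e : Fin m →₀ ℕ, weight v e = D →
      monomial e 1 ∈ Ideal.span (Set.range fun i => pderiv i f)) :
    ∃ c, ((jacobianMatrix v D f).submatrix id c).det ≠ 0 := by
  classical
  refine Matrix.exists_det_ne_zero_of_forall_vecMul_eq_zero _ fun l hl => ?_
  let Λ : MvPolynomial (Fin m) ℂ →ₗ[ℂ] ℂ := ∑ s, l s • lcoeff ℂ s.1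
  have hΛ : ∀ p, Λ p = ∑ s, l s * coeff s.1 p := fun p => by simp [Λ]
  have hmonomial : ∀ i u, Λ (monomial u 1 * pderiv i f) = 0 := by
    intro i u
    rw [hΛ]
    by_cases hu : weight v u + (1 - v i) = D
    · exact hl ⟨i, u, hu⟩
    · have hmul := (isWeightedHomogeneous_monomial v u (1 : ℂ) rfl).mul
        (h.pderiv (i := i) (sub_add_cancel 1 (v i)))
      refine Finset.sum_eq_zero fun s _ => ?_
      rw [hmul.coeff_eq_zero s.1 fun hs => hu (hs.symm.trans s.2), mul_zero]
  have hmul : ∀ i g, Λ (g * pderiv i f) = 0 := by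
    intro i g
    induction g using MvPolynomial.induction_on' with
    | monomial u a =>
      have : (monomial u a : MvPolynomial (Fin m) ℂ) = a • monomial u 1 := by
        rw [smul_monomial, smul_eq_mul, mul_one]
      rw [this, smul_mul_assoc, map_smul, hmonomial, smul_zero]
    | add p q hp hq => rw [add_mul, map_add, hp, hq, add_zero]
  funext s
  obtain ⟨g, hg⟩ := Ideal.mem_span_range_iff_exists_fun.mp (hD s.1 s.2)
  have hs : Λ (monomial s.1 1) = 0 := by
    rw [← hg, map_sum]
    exact Finset.sum_eq_zero fun i _ => hmul i (g i)
  simpa [hΛ, coeff_monomial, Subtype.coe_inj] using hs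

end Jacobian

/-- There are arbitrarily large degrees in which every variable has a pure power. -/
theorem exists_degree_gt {ι : Type*} [Fintype ι] {v : ι → ℚ} (hv : ∀ i, 0 < v i) (B : ℚ) :
    ∃ D : ℚ, B < D ∧ ∀ i, ∃ N : ℕ, N * v i = D := by
  obtain ⟨k, hk⟩ := exists_nat_gt B
  have hnum : ∀ i, ((v i).num.toNat : ℚ) = v i * (v i).den := fun i => by
    rw [Rat.mul_den_eq_num]
    exact_mod_cast Int.toNat_of_nonneg (Rat.num_nonneg.mpr (hv i).le)
  refine ⟨(k * ∏ i, (v i).num.toNat : ℕ), hk.trans_le ?_, fun i => ?_⟩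
  · have hpos : 0 < ∏ i, (v i).num.toNat :=
      Finset.prod_pos fun i _ => by have := Rat.num_pos.mpr (hv i); omega
    exact_mod_cast Nat.le_mul_of_pos_right k hpos
  · obtain ⟨a, ha⟩ := Finset.dvd_prod_of_mem (fun i => (v i).num.toNat) (Finset.mem_univ i)
    refine ⟨k * ((v i).den * a), ?_⟩
    rw [ha]
    push_cast
    rw [hnum]
    ring

/-- **Theorem 2.3.** Fix weights `w_i ≥ 2` admitting some weighted homogeneous polynomial
with an isolated singularity at the origin.  Then in the space `ℂ[Δ]` of all polynomials
weighted homogeneous of type `(w_0,…,w_n)` (whose monomial exponents range over the lattice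
points `d` of the hyperplane `∑ d i / w i = 1`), the subset of those with an isolated
singularity at the origin is nonempty and Zariski open: there are finitely many polynomial
functions of the coefficients (in the monomial basis of `ℂ[Δ]`) whose common zero locus is
exactly the complement. -/
theorem isolated_singularity_zariski_open
    (n : ℕ) (w : Fin (n + 1) → ℚ) (hw : ∀ i, 2 ≤ w i)
    (hex : ∃ f : MvPolynomial (Fin (n + 1)) ℂ,
      IsWeightedHomogeneousOfType w f ∧ HasIsolatedSingularityAtOrigin f) :
    (∃ f : MvPolynomial (Fin (n + 1)) ℂ,
      IsWeightedHomogeneousOfType w f ∧ HasIsolatedSingularityAtOrigin f) ∧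
    ∃ (k : ℕ)
      (P : Fin k → MvPolynomial {d : Fin (n + 1) →₀ ℕ // (∑ i, (d i : ℚ) / w i) = 1} ℂ),
      ∀ f : MvPolynomial (Fin (n + 1)) ℂ, IsWeightedHomogeneousOfType w f →
        (¬ HasIsolatedSingularityAtOrigin f ↔
          ∀ j, eval (fun d => coeff d.1 f) (P j) = 0) := by
  refine ⟨hex, ?_⟩
  let v : Fin (n + 1) → ℚ := fun i => (w i)⁻¹
  have hv : ∀ i, 0 < v i := fun i => inv_pos.mpr (two_pos.trans_le (hw i))
  have hweight : ∀ d : Fin (n + 1) →₀ ℕ, weight v d = ∑ i, (d i : ℚ) / w i := fun d => by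
    simp [weight_eq_sum, v, div_eq_mul_inv]
  have hfinite : ∀ D : ℚ, Finite {d : Fin (n + 1) →₀ ℕ // weight v d = D} :=
    finite_weight_eq hv
  let := fun D => @Fintype.ofFinite _ (hfinite D)
  have hfin : Finite {d : Fin (n + 1) →₀ ℕ // (∑ i, (d i : ℚ) / w i) = 1} := by
    simpa only [hweight] using hfinite 1
  let := Fintype.ofFinite {d : Fin (n + 1) →₀ ℕ // (∑ i, (d i : ℚ) / w i) = 1}
  let F : MvPolynomial (Fin (n + 1))
      (MvPolynomial {d : Fin (n + 1) →₀ ℕ // (∑ i, (d i : ℚ) / w i) = 1} ℂ) :=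
    ∑ d, monomial d.1 (X d)
  obtain ⟨k, P, hP⟩ := exists_fin_forall_eval_eq_zero_iff
    {p | ∃ D : ℚ, (∀ i, ∃ N : ℕ, N * v i = D) ∧
      ∃ c, p = ((jacobianMatrix v D F).submatrix id c).det}
  refine ⟨k, P, fun f hf => ?_⟩
  have hf' : f.IsWeightedHomogeneous v 1 := fun d hd =>
    (hweight d).trans (hf d (mem_support_iff.mpr hd))
  have hF : map (eval fun d => coeff d.1 f) F = f := by
    ext e
    simp only [F, map_sum, map_monomial, eval_X, coeff_sum, coeff_monomial]
    by_cases he : (∑ i, (e i : ℚ) / w i) = 1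
    · rw [Finset.sum_eq_single ⟨e, he⟩ (fun d _ hd => if_neg fun h => hd (Subtype.ext h))
        (by simp), if_pos rfl]
    · rw [Finset.sum_eq_zero fun d _ => if_neg fun h : d.1 = e => he (h ▸ d.2)]
      exact (notMem_support_iff.mp fun h => he (hf e h)).symm
  have hdet : ∀ (D : ℚ) (c : {e : Fin (n + 1) →₀ ℕ // weight v e = D} → _),
      eval (fun d => coeff d.1 f) ((jacobianMatrix v D F).submatrix id c).det
        = ((jacobianMatrix v D f).submatrix id c).det := by
    intro D c
    conv_rhs => rw [← hF, jacobianMatrix_map]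
    rw [RingHom.map_det]
    rfl
  rw [hP, hf'.hasIsolatedSingularityAtOrigin_iff hv]
  refine ⟨?_, fun hzero hcrit => ?_⟩
  · rintro hcrit _ ⟨D, hD, c, rfl⟩
    by_contra hne
    rw [hdet] at hne
    exact hcrit fun z hz => eq_zero_of_det_jacobianMatrix_ne_zero hf' hD hne hz
  · obtain ⟨B, hB⟩ := exists_forall_monomial_mem_span_pderiv hv hcrit
    obtain ⟨D, hBD, hD⟩ := exists_degree_gt hv B
    obtain ⟨c, hc⟩ := exists_det_jacobianMatrix_ne_zero (D := D) hf'
      fun e he => hB e (he ▸ hBD)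
    exact hc ((hdet D c).symm.trans (hzero _ ⟨D, hD, c, rfl⟩))
end

section
/- Let h ∈ ℂ[z_0,z_1,z_2,z_3] be a polynomial such that h(0) = 0, all four partial derivatives ∂h/∂z_0, ∂h/∂z_1, ∂h/∂z_2, ∂h/∂z_3 vanish at the origin, and h has an isolated singularity at the origin. Then for every index j ∈ {0,1,2,3} there exists an integer k ≥ 1 such that either the monomial z_j^k occurs in h, or there exists an index i ≠ j such that the monomial z_j^k z_i occurs in h. -/
open MvPolynomial

namespace MvPolynomial

variable {σ R : Type*} [CommSemiring R] [DecidableEq σ]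

/-- A polynomial in which no power of `X j` occurs vanishes on the `j`-th coordinate axis. -/
theorem eval_piSingle_eq_zero_of_coeff_single_eq_zero {p : MvPolynomial σ R} {j : σ}
    (hp : ∀ k : ℕ, coeff (Finsupp.single j k) p = 0) (t : R) :
    eval (Pi.single j t : σ → R) p = 0 := by
  rw [eval_eq]
  refine Finset.sum_eq_zero fun d hd => ?_
  obtain ⟨i, hij, hi⟩ : ∃ i, i ≠ j ∧ d i ≠ 0 := by
    by_contra! hcon
    have hd_single : d = Finsupp.single j (d j) := by
      ext i
      by_cases hij : i = j
      · subst hij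
        simp
      · rw [Finsupp.single_eq_of_ne hij, hcon i hij]
    rw [mem_support_iff, hd_single] at hd
    exact hd (hp _)
  rw [Finset.prod_eq_zero (Finsupp.mem_support_iff.mpr hi), mul_zero]
  rw [Pi.single_eq_of_ne hij, zero_pow hi]

/-- If `p` and its partial derivatives vanish at the origin and no monomial `X j ^ k` or
`X j ^ k * X i` with `1 ≤ k` and `i ≠ j` occurs in `p`, then `p` and its partial derivatives
vanish on the `j`-th coordinate axis. -/
theorem eval_piSingle_eq_zero_and_eval_pderiv_eq_zero {p : MvPolynomial σ R} {j : σ}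
    (h0 : eval (0 : σ → R) p = 0) (hd : ∀ i, eval (0 : σ → R) (pderiv i p) = 0)
    (hpow : ∀ k : ℕ, 1 ≤ k → coeff (Finsupp.single j k) p = 0)
    (hmul : ∀ k : ℕ, 1 ≤ k → ∀ i, i ≠ j →
      coeff (Finsupp.single j k + Finsupp.single i 1) p = 0) (t : R) :
    eval (Pi.single j t : σ → R) p = 0 ∧
      ∀ i, eval (Pi.single j t : σ → R) (pderiv i p) = 0 := by
  have coeff_zero {q : MvPolynomial σ R} (hq : eval (0 : σ → R) q = 0) :
      coeff (Finsupp.single j 0) q = 0 := by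
    rwa [Finsupp.single_zero, ← constantCoeff_eq, ← eval_zero]
  refine ⟨eval_piSingle_eq_zero_of_coeff_single_eq_zero (fun k => ?_) t,
    fun i => eval_piSingle_eq_zero_of_coeff_single_eq_zero (fun k => ?_) t⟩
  · rcases Nat.eq_zero_or_pos k with rfl | hk
    · exact coeff_zero h0
    · exact hpow k hk
  · rcases Nat.eq_zero_or_pos k with rfl | hk
    · exact coeff_zero (hd i)
    · rw [coeff_pderiv]
      by_cases hij : i = j
      · subst hij
        rw [← Finsupp.single_add, hpow _ (Nat.le_add_left 1 k), zero_mul]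
      · rw [hmul k hk i hij, zero_mul]

end MvPolynomial

/-- Key lemma in the proof of Theorem 2.1:  if `h ∈ ℂ[z_0,z_1,z_2,z_3]` vanishes at the
origin together with its four first-order partial derivatives, and `h` has an isolated
singularity at the origin, then for each index `j` some monomial of the form `z_j^k` or
`z_j^k z_i` (with `i ≠ j`, `k ≥ 1`) occurs in `h`. -/
theorem exists_monomial_pure_power_or_power_times_other
    (h : MvPolynomial (Fin 4) ℂ)
    (h0 : eval (0 : Fin 4 → ℂ) h = 0)
    (hd : ∀ j : Fin 4, eval (0 : Fin 4 → ℂ) (pderiv j h) = 0)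
    (hiso : HasIsolatedSingularityAtOrigin h) :
    ∀ j : Fin 4, ∃ k : ℕ, 1 ≤ k ∧
      (coeff (Finsupp.single j k) h ≠ 0 ∨
        ∃ i : Fin 4, i ≠ j ∧ coeff (Finsupp.single j k + Finsupp.single i 1) h ≠ 0) := by
  intro j
  by_contra! hcon
  obtain ⟨ε, hε, hz⟩ := hiso
  have hnorm : ‖(Pi.single j ((ε / 2 : ℝ) : ℂ) : Fin 4 → ℂ)‖ < ε := by
    rw [Pi.norm_single, Complex.norm_real, Real.norm_of_nonneg (by positivity)]
    exact half_lt_self hε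
  have hzero := hz _ hnorm <| eval_piSingle_eq_zero_and_eval_pderiv_eq_zero h0 hd
    (fun k hk => (hcon k hk).1) (fun k hk => (hcon k hk).2) _
  rw [Pi.single_eq_zero_iff, Complex.ofReal_eq_zero] at hzero
  exact (half_pos hε).ne' hzero
end

section
/- Let a, b, c, d be integers ≥ 2 and let f = z_0^a + z_1^b + z_2^c + z_2 z_3^d ∈ ℂ[z_0,z_1,z_2,z_3] (Type II of the classification). Then the Milnor number of f satisfies μ(f) = (a-1)(b-1)(c(d-1)+1); that is, the complex dimension of ℂ[z_0,z_1,z_2,z_3]/(∂f/∂z_0, ∂f/∂z_1, ∂f/∂z_2, ∂f/∂z_3) equals (a-1)(b-1)(c(d-1)+1). -/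
open MvPolynomial

namespace TypeIIMilnor

variable {K : Type*} [Field K]

/-- The exponents of the standard monomials of the ideal
`(X₀ ^ p, X₁ ^ q, u X₂ ^ n + X₃ ^ (m + 1), X₂ X₃ ^ m)`. -/
abbrev Index (p q n m : ℕ) : Type :=
  (Fin p × Fin q) × (Fin (n + 1) × Fin m ⊕ Unit)

/-- The exponent vector of a standard monomial. -/
def expo {p q n m : ℕ} : Index p q n m → ℕ × ℕ × ℕ × ℕ
  | ((k, l), .inl (i, j)) => (k, l, i, j)
  | ((k, l), .inr _) => (k, l, 0, m)

lemma expo_injective {p q n m : ℕ} :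
    Function.Injective (expo (p := p) (q := q) (n := n) (m := m)) := by
  rintro ⟨⟨k, l⟩, ⟨i, j⟩ | _⟩ ⟨⟨k', l'⟩, ⟨i', j'⟩ | _⟩ h <;>
    simp only [expo, Prod.mk.injEq, Sum.inl.injEq, Fin.ext_iff, reduceCtorEq] at h ⊢ <;> grind

lemma mem_range_expo {p q n m : ℕ} (k l i j : ℕ) :
    (∃ t : Index p q n m, expo t = (k, l, i, j)) ↔
      k < p ∧ l < q ∧ (i ≤ n ∧ j < m ∨ i = 0 ∧ j = m) := by
  constructor
  · rintro ⟨⟨⟨k', l'⟩, ⟨i', j'⟩ | _⟩, h⟩ <;> simp only [expo, Prod.mk.injEq] at h <;> grind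
  · rintro ⟨hk, hl, ⟨hi, hj⟩ | ⟨rfl, rfl⟩⟩
    · exact ⟨((⟨k, hk⟩, ⟨l, hl⟩), .inl (⟨i, by omega⟩, ⟨j, hj⟩)), rfl⟩
    · exact ⟨((⟨k, hk⟩, ⟨l, hl⟩), .inr ()), rfl⟩

/-- The vector of a monomial in the standard basis, zero if the monomial is not standard. -/
def standardVec (K : Type*) [Field K] (p q n m k l i j : ℕ) : Index p q n m → K :=
  fun t => if expo t = (k, l, i, j) then 1 else 0

lemma standardVec_eq_zero {p q n m k l i j : ℕ}
    (h : ¬ (k < p ∧ l < q ∧ (i ≤ n ∧ j < m ∨ i = 0 ∧ j = m))) :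
    standardVec K p q n m k l i j = 0 := by
  ext t
  exact if_neg fun ht => h ((mem_range_expo k l i j).1 ⟨t, ht⟩)

lemma standardVec_eq_single {p q n m k l i j : ℕ} (t : Index p q n m)
    (h : expo t = (k, l, i, j)) :
    standardVec K p q n m k l i j = Pi.single t 1 := by
  ext s
  simp [standardVec, ← h, expo_injective.eq_iff, Pi.single_apply]

/-- The normal form of the monomial with exponents `k, l, i, j`. -/
def normalVec (u : K) (p q n m k l i j : ℕ) : Index p q n m → K :=
  if i = 0 ∧ m + 1 ≤ j then -u • standardVec K p q n m k l n (j - (m + 1))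
  else standardVec K p q n m k l i j

lemma normalVec_eq_zero_of_le_first (u : K) {p q n m k l i j : ℕ} (h : p ≤ k) :
    normalVec u p q n m k l i j = 0 := by
  unfold normalVec
  split_ifs <;> simp [standardVec_eq_zero, h.not_gt]

lemma normalVec_eq_zero_of_le_second (u : K) {p q n m k l i j : ℕ} (h : q ≤ l) :
    normalVec u p q n m k l i j = 0 := by
  unfold normalVec
  split_ifs <;> simp [standardVec_eq_zero, h.not_gt]

lemma normalVec_eq_zero_of_le_fourth (u : K) {p q n m k l i j : ℕ} (hi : 1 ≤ i) (hj : m ≤ j) :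
    normalVec u p q n m k l i j = 0 := by
  rw [normalVec, if_neg (by omega), standardVec_eq_zero (by omega)]

lemma normalVec_relation (u : K) {p q n m : ℕ} (hn : 1 ≤ n) (k l i j : ℕ) :
    u • normalVec u p q n m k l (i + n) j + normalVec u p q n m k l i (j + (m + 1)) = 0 := by
  rcases Nat.eq_zero_or_pos i with rfl | hi
  · rw [normalVec, normalVec, if_neg (by omega), if_pos (by omega)]
    simp
  · rw [normalVec, normalVec, if_neg (by omega), if_neg (by omega),
      standardVec_eq_zero (by omega), standardVec_eq_zero (by omega)]
    simp

/-- The monomial with the given four exponents. -/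
noncomputable def mon (K : Type*) [Field K] (k l i j : ℕ) : MvPolynomial (Fin 4) K :=
  X 0 ^ k * X 1 ^ l * X 2 ^ i * X 3 ^ j

lemma monomial_eq_mon (s : Fin 4 →₀ ℕ) :
    monomial s (1 : K) = mon K (s 0) (s 1) (s 2) (s 3) := by
  rw [monomial_eq, Finsupp.prod_fintype _ _ (by simp)]
  simp [Fin.prod_univ_four, mon]

/-- Linear extension of the normal form of monomials. -/
noncomputable def normalForm (u : K) (p q n m : ℕ) :
    MvPolynomial (Fin 4) K →ₗ[K] (Index p q n m → K) :=
  (basisMonomials (Fin 4) K).constr K fun s => normalVec u p q n m (s 0) (s 1) (s 2) (s 3)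

lemma normalForm_mon (u : K) (p q n m k l i j : ℕ) :
    normalForm u p q n m (mon K k l i j) = normalVec u p q n m k l i j := by
  have h : basisMonomials (Fin 4) K (Finsupp.equivFunOnFinite.symm ![k, l, i, j]) =
      mon K k l i j := by
    simp [monomial_eq_mon]
  rw [← h, normalForm, Module.Basis.constr_basis]
  simp

lemma linearMap_ext_mon {V : Type*} [AddCommGroup V] [Module K V]
    {f g : MvPolynomial (Fin 4) K →ₗ[K] V}
    (h : ∀ k l i j, f (mon K k l i j) = g (mon K k l i j)) : f = g := by
  refine (basisMonomials (Fin 4) K).ext fun s => ?_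
  simpa only [coe_basisMonomials, monomial_eq_mon] using h _ _ _ _

/-- The ideal `(X₀ ^ p, X₁ ^ q, u X₂ ^ n + X₃ ^ (m + 1), X₂ X₃ ^ m)`. -/
noncomputable def relIdeal (u : K) (p q n m : ℕ) : Ideal (MvPolynomial (Fin 4) K) :=
  Ideal.span {X 0 ^ p, X 1 ^ q, u • X 2 ^ n + X 3 ^ (m + 1), X 2 * X 3 ^ m}

lemma relIdeal_le_ker (u : K) {p q n m : ℕ} (hn : 1 ≤ n) :
    (relIdeal u p q n m).restrictScalars K ≤ LinearMap.ker (normalForm u p q n m) := by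
  have key : ∀ g ∈ ({X 0 ^ p, X 1 ^ q, u • X 2 ^ n + X 3 ^ (m + 1), X 2 * X 3 ^ m} :
      Set (MvPolynomial (Fin 4) K)),
      normalForm u p q n m ∘ₗ LinearMap.mulRight K g = 0 := by
    intro g hg
    refine linearMap_ext_mon fun k l i j => ?_
    rw [LinearMap.comp_apply, LinearMap.mulRight_apply, LinearMap.zero_apply]
    rcases hg with rfl | rfl | rfl | rfl
    · rw [show mon K k l i j * X 0 ^ p = mon K (k + p) l i j by simp only [mon]; ring,
        normalForm_mon, normalVec_eq_zero_of_le_first u (by omega)]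
    · rw [show mon K k l i j * X 1 ^ q = mon K k (l + q) i j by simp only [mon]; ring,
        normalForm_mon, normalVec_eq_zero_of_le_second u (by omega)]
    · rw [show mon K k l i j * (u • X 2 ^ n + X 3 ^ (m + 1)) =
          u • mon K k l (i + n) j + mon K k l i (j + (m + 1)) by
            simp only [mon, smul_eq_C_mul]; ring,
        map_add, map_smul, normalForm_mon, normalForm_mon, normalVec_relation u hn]
    · rw [show mon K k l i j * (X 2 * X 3 ^ m) = mon K k l (i + 1) (j + m) by
            simp only [mon]; ring,
        normalForm_mon, normalVec_eq_zero_of_le_fourth u (by omega) (by omega)]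
  intro x hx
  rw [Submodule.restrictScalars_mem, relIdeal] at hx
  rw [LinearMap.mem_ker]
  induction hx using Submodule.closure_induction with
  | zero => simp
  | add x y _ _ hx hy => rw [map_add, hx, hy, add_zero]
  | smul_mem r x hx => exact LinearMap.congr_fun (key x hx) r

lemma normalForm_surjective (u : K) (p q n m : ℕ) :
    Function.Surjective (normalForm u p q n m) := by
  rw [← LinearMap.range_eq_top, ← top_le_iff, ← (Pi.basisFun K (Index p q n m)).span_eq,
    Submodule.span_le]
  rintro _ ⟨t, rfl⟩
  obtain ⟨⟨k, l, i, j⟩, ht⟩ : ∃ e, expo t = e := ⟨_, rfl⟩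
  have hm := (mem_range_expo (p := p) (q := q) (n := n) (m := m) k l i j).1 ⟨t, ht⟩
  refine ⟨mon K k l i j, ?_⟩
  rw [normalForm_mon, normalVec, if_neg (by omega), standardVec_eq_single t ht,
    Pi.basisFun_apply]

section Reconstruction

variable {u : K} {p q n m k l i j : ℕ}

lemma mon_mem_of_le_first (h : p ≤ k) : mon K k l i j ∈ relIdeal u p q n m := by
  obtain ⟨k, rfl⟩ := Nat.exists_eq_add_of_le' h
  rw [show mon K (k + p) l i j = mon K k l i j * X 0 ^ p by simp only [mon]; ring]
  exact Ideal.mul_mem_left _ _ (Ideal.subset_span (by simp))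

lemma mon_mem_of_le_second (h : q ≤ l) : mon K k l i j ∈ relIdeal u p q n m := by
  obtain ⟨l, rfl⟩ := Nat.exists_eq_add_of_le' h
  rw [show mon K k (l + q) i j = mon K k l i j * X 1 ^ q by simp only [mon]; ring]
  exact Ideal.mul_mem_left _ _ (Ideal.subset_span (by simp))

lemma mon_mem_of_le_fourth (hi : 1 ≤ i) (hj : m ≤ j) : mon K k l i j ∈ relIdeal u p q n m := by
  obtain ⟨i, rfl⟩ := Nat.exists_eq_add_of_le' hi
  obtain ⟨j, rfl⟩ := Nat.exists_eq_add_of_le' hj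
  rw [show mon K k l (i + 1) (j + m) = mon K k l i j * (X 2 * X 3 ^ m) by
    simp only [mon]; ring]
  exact Ideal.mul_mem_left _ _ (Ideal.subset_span (by simp))

lemma smul_mon_add_mon_mem :
    u • mon K k l (i + n) j + mon K k l i (j + (m + 1)) ∈ relIdeal u p q n m := by
  rw [show u • mon K k l (i + n) j + mon K k l i (j + (m + 1)) =
    mon K k l i j * (u • X 2 ^ n + X 3 ^ (m + 1)) by simp only [mon, smul_eq_C_mul]; ring]
  exact Ideal.mul_mem_left _ _ (Ideal.subset_span (by simp))

lemma mon_mem_of_lt_third (hu : u ≠ 0) (h : n < i) : mon K k l i j ∈ relIdeal u p q n m := by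
  obtain ⟨i, rfl⟩ := Nat.exists_eq_add_of_lt h
  have h₁ : u • mon K k l (n + i + 1) j ∈ relIdeal u p q n m := by
    have := smul_mon_add_mon_mem (u := u) (p := p) (q := q) (n := n) (m := m) (k := k) (l := l)
      (i := i + 1) (j := j)
    rw [show i + 1 + n = n + i + 1 by ring] at this
    exact (Ideal.add_mem_iff_left _ (mon_mem_of_le_fourth (by omega) (by omega))).1 this
  simpa [smul_smul, hu] using Submodule.smul_of_tower_mem _ u⁻¹ h₁

end Reconstruction

/-- The class of the combination of standard monomials with given coefficients. -/
noncomputable def reconstruct (u : K) (p q n m : ℕ) :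
    (Index p q n m → K) →ₗ[K] MvPolynomial (Fin 4) K ⧸ relIdeal u p q n m :=
  (Pi.basisFun K (Index p q n m)).constr K fun t =>
    Ideal.Quotient.mkₐ K (relIdeal u p q n m)
      (mon K (expo t).1 (expo t).2.1 (expo t).2.2.1 (expo t).2.2.2)

lemma reconstruct_standardVec {u : K} (hu : u ≠ 0) {p q n m k l i j : ℕ}
    (h : ¬ (i = 0 ∧ m + 1 ≤ j)) :
    reconstruct u p q n m (standardVec K p q n m k l i j) =
      Ideal.Quotient.mkₐ K (relIdeal u p q n m) (mon K k l i j) := by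
  by_cases ht : ∃ t : Index p q n m, expo t = (k, l, i, j)
  · obtain ⟨t, ht⟩ := ht
    rw [standardVec_eq_single t ht, ← Pi.basisFun_apply, reconstruct,
      Module.Basis.constr_basis, ht]
  · rw [mem_range_expo] at ht
    rw [standardVec_eq_zero ht, map_zero, eq_comm, Ideal.Quotient.mkₐ_eq_mk,
      Ideal.Quotient.eq_zero_iff_mem]
    by_cases hk : p ≤ k
    · exact mon_mem_of_le_first hk
    by_cases hl : q ≤ l
    · exact mon_mem_of_le_second hl
    by_cases hi : n < i
    · exact mon_mem_of_lt_third hu hi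
    exact mon_mem_of_le_fourth (by omega) (by omega)

lemma reconstruct_comp_normalForm {u : K} (hu : u ≠ 0) {p q n m : ℕ} (hn : 1 ≤ n) :
    reconstruct u p q n m ∘ₗ normalForm u p q n m =
      (Ideal.Quotient.mkₐ K (relIdeal u p q n m)).toLinearMap := by
  refine linearMap_ext_mon fun k l i j => ?_
  rw [LinearMap.comp_apply, normalForm_mon, AlgHom.toLinearMap_apply, normalVec]
  split_ifs with h
  · obtain ⟨rfl, hj⟩ := h
    obtain ⟨j, rfl⟩ := Nat.exists_eq_add_of_le' hj
    rw [Nat.add_sub_cancel, map_smul, reconstruct_standardVec hu (by omega), neg_smul,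
      neg_eq_iff_add_eq_zero, ← map_smul, ← map_add, Ideal.Quotient.mkₐ_eq_mk,
      Ideal.Quotient.eq_zero_iff_mem]
    simpa using smul_mon_add_mon_mem (u := u) (p := p) (q := q) (n := n) (m := m) (k := k)
      (l := l) (i := 0) (j := j)
  · exact reconstruct_standardVec hu h

lemma ker_normalForm {u : K} (hu : u ≠ 0) {p q n m : ℕ} (hn : 1 ≤ n) :
    LinearMap.ker (normalForm u p q n m) = (relIdeal u p q n m).restrictScalars K := by
  refine le_antisymm (fun x hx => ?_) (relIdeal_le_ker u hn)
  have h := LinearMap.congr_fun (reconstruct_comp_normalForm (p := p) (q := q) (m := m) hu hn) x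
  rw [LinearMap.comp_apply, LinearMap.mem_ker.1 hx, map_zero] at h
  exact Ideal.Quotient.eq_zero_iff_mem.1 h.symm

theorem finrank_quotient_relIdeal {u : K} (hu : u ≠ 0) {p q n m : ℕ} (hn : 1 ≤ n) :
    Module.finrank K (MvPolynomial (Fin 4) K ⧸ relIdeal u p q n m) =
      p * q * ((n + 1) * m + 1) := by
  rw [← (Submodule.Quotient.restrictScalarsEquiv K (relIdeal u p q n m)).finrank_eq,
    ← ker_normalForm hu hn,
    ((normalForm u p q n m).quotKerEquivOfSurjective (normalForm_surjective u p q n m)).finrank_eq]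
  simp

lemma span_pderiv_eq_relIdeal [CharZero K] {a b c d : ℕ} (ha : a ≠ 0) (hb : b ≠ 0)
    (hd : d ≠ 0) :
    Ideal.span (Set.range fun i : Fin 4 =>
      pderiv i (X 0 ^ a + X 1 ^ b + X 2 ^ c + X 2 * X 3 ^ d : MvPolynomial (Fin 4) K)) =
      relIdeal (c : K) (a - 1) (b - 1) (c - 1) (d - 1) := by
  have hunit : ∀ e : ℕ, e ≠ 0 → IsUnit (e : MvPolynomial (Fin 4) K) := fun e he => by
    have : IsUnit (e : K) := by simpa using he
    simpa using this.map (C : K →+* MvPolynomial (Fin 4) K)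
  have h₀ : pderiv 0 (X 0 ^ a + X 1 ^ b + X 2 ^ c + X 2 * X 3 ^ d : MvPolynomial (Fin 4) K) =
      (a : MvPolynomial (Fin 4) K) * X 0 ^ (a - 1) := by
    simp [pderiv_X, Derivation.leibniz_pow]
  have h₁ : pderiv 1 (X 0 ^ a + X 1 ^ b + X 2 ^ c + X 2 * X 3 ^ d : MvPolynomial (Fin 4) K) =
      (b : MvPolynomial (Fin 4) K) * X 1 ^ (b - 1) := by
    simp [pderiv_X, Derivation.leibniz_pow]
  have h₂ : pderiv 2 (X 0 ^ a + X 1 ^ b + X 2 ^ c + X 2 * X 3 ^ d : MvPolynomial (Fin 4) K) =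
      (c : K) • X 2 ^ (c - 1) + X 3 ^ (d - 1 + 1) := by
    simp [pderiv_X, Derivation.leibniz_pow, smul_eq_C_mul,
      Nat.sub_add_cancel (Nat.pos_of_ne_zero hd)]
  have h₃ : pderiv 3 (X 0 ^ a + X 1 ^ b + X 2 ^ c + X 2 * X 3 ^ d : MvPolynomial (Fin 4) K) =
      (d : MvPolynomial (Fin 4) K) * (X 2 * X 3 ^ (d - 1)) := by
    simp [pderiv_X, Derivation.leibniz_pow]
    ring
  refine le_antisymm ?_ ?_
  · rw [Ideal.span_le]
    rintro _ ⟨i, rfl⟩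
    fin_cases i
    · exact Set.mem_of_eq_of_mem h₀ (Ideal.mul_mem_left _ _ (Ideal.subset_span (by simp)))
    · exact Set.mem_of_eq_of_mem h₁ (Ideal.mul_mem_left _ _ (Ideal.subset_span (by simp)))
    · exact Set.mem_of_eq_of_mem h₂ (Ideal.subset_span (by simp))
    · exact Set.mem_of_eq_of_mem h₃ (Ideal.mul_mem_left _ _ (Ideal.subset_span (by simp)))
  · rw [relIdeal, Ideal.span_le]
    rintro _ (rfl | rfl | rfl | rfl)
    · exact (Ideal.unit_mul_mem_iff_mem _ (hunit a ha)).1 (Ideal.subset_span ⟨0, h₀⟩)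
    · exact (Ideal.unit_mul_mem_iff_mem _ (hunit b hb)).1 (Ideal.subset_span ⟨1, h₁⟩)
    · exact Ideal.subset_span ⟨2, h₂⟩
    · exact (Ideal.unit_mul_mem_iff_mem _ (hunit d hd)).1 (Ideal.subset_span ⟨3, h₃⟩)

end TypeIIMilnor

/-- Milnor number formula for Type II:  for `f = z_0^a + z_1^b + z_2^c + z_2 z_3^d` with
`a, b, c, d ≥ 2`, the complex dimension of the Milnor algebra equals
`(a-1)(b-1)(c(d-1)+1)`. -/
theorem milnor_number_type_II
    (a b c d : ℕ) (ha : 2 ≤ a) (hb : 2 ≤ b) (hc : 2 ≤ c) (hd : 2 ≤ d) :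
    Module.finrank ℂ
      (MvPolynomial (Fin 4) ℂ ⧸
        Ideal.span (Set.range fun i : Fin 4 =>
          pderiv i (X 0 ^ a + X 1 ^ b + X 2 ^ c + X 2 * X 3 ^ d : MvPolynomial (Fin 4) ℂ)))
      = (a - 1) * (b - 1) * (c * (d - 1) + 1) := by
  rw [TypeIIMilnor.span_pderiv_eq_relIdeal (by omega) (by omega) (by omega),
    TypeIIMilnor.finrank_quotient_relIdeal (Nat.cast_ne_zero.2 (by omega)) (by omega),
    Nat.sub_add_cancel (by omega : 1 ≤ c)]
end

section
/- Let a, b, c, d be integers ≥ 2 and let f = z_0^a z_1 + z_0 z_1^b + z_2^c z_3 + z_2 z_3^d ∈ ℂ[z_0,z_1,z_2,z_3] (Type VI of the classification). Then the Milnor number of f satisfies μ(f) = abcd; that is, the complex dimension of ℂ[z_0,z_1,z_2,z_3]/(∂f/∂z_0, ∂f/∂z_1, ∂f/∂z_2, ∂f/∂z_3) equals abcd. -/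
open MvPolynomial

/-- The coefficient of `x ^ p * y ^ q` (with `p < a`, `q < b`) in the normal form of `x ^ i * y ^ j`
modulo the partial derivatives of `x ^ a * y + x * y ^ b`. -/
noncomputable def normalFormCoeff (a b i j p q : ℕ) : ℂ :=
  if i < a ∧ j < b then (if p = i ∧ q = j then 1 else 0)
  else if i = 0 ∧ p + 1 = a ∧ q + b = j + 1 then -a
  else if j = 0 ∧ q + 1 = b ∧ p + a = i + 1 then -b
  else 0

theorem normalFormCoeff_swap {a b : ℕ} (ha : 2 ≤ a) (hb : 2 ≤ b) (i j p q : ℕ) :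
    normalFormCoeff b a j i q p = normalFormCoeff a b i j p q := by
  unfold normalFormCoeff
  split_ifs <;> first | rfl | (exfalso; omega)

theorem normalFormCoeff_relation {a b : ℕ} (ha : 2 ≤ a) (hb : 2 ≤ b) (i j : ℕ) {p q : ℕ}
    (hp : p < a) (hq : q < b) :
    a * normalFormCoeff a b (i + (a - 1)) (j + 1) p q + normalFormCoeff a b i (j + b) p q = 0 := by
  unfold normalFormCoeff
  split_ifs <;> first | (exfalso; omega) | simp_all

theorem normalFormCoeff_relation' {a b : ℕ} (ha : 2 ≤ a) (hb : 2 ≤ b) (i j : ℕ) {p q : ℕ}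
    (hp : p < a) (hq : q < b) :
    normalFormCoeff a b (i + a) j p q + b * normalFormCoeff a b (i + 1) (j + (b - 1)) p q = 0 := by
  rw [← normalFormCoeff_swap ha hb, ← normalFormCoeff_swap ha hb, add_comm]
  exact normalFormCoeff_relation hb ha j i hq hp

theorem sum_normalFormCoeff_eq_of_eq_ite {B : Type*} [CommRing B] [Algebra ℂ B] {a b i j : ℕ}
    (x y : B) (t : ℂ) {p₀ q₀ : ℕ} (hp₀ : p₀ < a) (hq₀ : q₀ < b)
    (h : ∀ p < a, ∀ q < b, normalFormCoeff a b i j p q = if p = p₀ ∧ q = q₀ then t else 0) :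
    ∑ e : Fin a × Fin b, normalFormCoeff a b i j e.1 e.2 • (x ^ (e.1 : ℕ) * y ^ (e.2 : ℕ)) =
      t • (x ^ p₀ * y ^ q₀) := by
  rw [Finset.sum_eq_single (⟨p₀, hp₀⟩, ⟨q₀, hq₀⟩)]
  · simp [h p₀ hp₀ q₀ hq₀]
  · rintro ⟨p, q⟩ - hne
    rw [h p p.2 q q.2, if_neg, zero_smul]
    rintro ⟨h₁, h₂⟩
    exact hne (Prod.ext (Fin.ext h₁) (Fin.ext h₂))
  · simp

section Relations

variable {B : Type*} [CommRing B] [Algebra ℂ B] {a b : ℕ} {x y : B}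

theorem mul_pow_eq_zero_of_relations (ha : 2 ≤ a) (hb : 2 ≤ b)
    (h₁ : (a : B) * x ^ (a - 1) * y + y ^ b = 0) (h₂ : x ^ a + (b : B) * x * y ^ (b - 1) = 0) :
    x * y ^ b = 0 := by
  obtain ⟨a, rfl⟩ := Nat.exists_eq_add_of_le' ha
  obtain ⟨b, rfl⟩ := Nat.exists_eq_add_of_le' hb
  have key : (1 - ((a + 2 : ℕ) : ℂ) * ((b + 2 : ℕ) : ℂ)) • (x * y ^ (b + 2)) = 0 := by
    rw [Algebra.smul_def]
    simp only [map_sub, map_mul, map_one, map_natCast]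
    simp only [show a + 2 - 1 = a + 1 by omega,
      show b + 2 - 1 = b + 1 by omega] at h₁ h₂
    linear_combination x * h₁ - ((a + 2 : ℕ) : B) * y * h₂
  refine (smul_eq_zero.1 key).resolve_left ?_
  rw [sub_eq_zero]
  norm_cast
  nlinarith

theorem sum_normalFormCoeff_smul (ha : 2 ≤ a) (hb : 2 ≤ b)
    (h₁ : (a : B) * x ^ (a - 1) * y + y ^ b = 0) (h₂ : x ^ a + (b : B) * x * y ^ (b - 1) = 0)
    (i j : ℕ) :
    ∑ e : Fin a × Fin b, normalFormCoeff a b i j e.1 e.2 • (x ^ (e.1 : ℕ) * y ^ (e.2 : ℕ)) =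
      x ^ i * y ^ j := by
  have hxy : x * y ^ b = 0 := mul_pow_eq_zero_of_relations ha hb h₁ h₂
  have hyx : y * x ^ a = 0 :=
    mul_pow_eq_zero_of_relations hb ha (by linear_combination h₂) (by linear_combination h₁)
  by_cases hij : i < a ∧ j < b
  · rw [sum_normalFormCoeff_eq_of_eq_ite x y 1 hij.1 hij.2, one_smul]
    intro p _ q _
    simp [normalFormCoeff, hij]
  by_cases hi : i = 0 ∧ j + 1 < 2 * b
  · obtain ⟨rfl, hj⟩ := hi
    obtain ⟨k, rfl⟩ := Nat.exists_eq_add_of_le (show b ≤ j by omega)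
    rw [sum_normalFormCoeff_eq_of_eq_ite x y (-a) (p₀ := a - 1) (q₀ := k + 1) (by omega) (by omega)]
    · rw [Algebra.smul_def]
      simp only [map_neg, map_natCast]
      linear_combination (-y ^ k) * h₁
    · intro p _ q _
      unfold normalFormCoeff
      split_ifs <;> first | rfl | (exfalso; omega)
  by_cases hj : j = 0 ∧ i + 1 < 2 * a
  · obtain ⟨rfl, hi⟩ := hj
    obtain ⟨k, rfl⟩ := Nat.exists_eq_add_of_le (show a ≤ i by omega)
    rw [sum_normalFormCoeff_eq_of_eq_ite x y (-b) (p₀ := k + 1) (q₀ := b - 1) (by omega) (by omega)]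
    · rw [Algebra.smul_def]
      simp only [map_neg, map_natCast]
      linear_combination (-x ^ k) * h₂
    · intro p _ q _
      unfold normalFormCoeff
      split_ifs <;> first | rfl | (exfalso; omega)
  · rw [sum_normalFormCoeff_eq_of_eq_ite x y 0 (p₀ := 0) (q₀ := 0) (by omega) (by omega), zero_smul]
    · symm
      rcases Nat.eq_zero_or_pos i with rfl | hi0
      · obtain ⟨k, rfl⟩ := Nat.exists_eq_add_of_le (show b + (b - 1) ≤ j by omega)
        obtain ⟨a, rfl⟩ := Nat.exists_eq_add_of_le' ha
        obtain ⟨b, rfl⟩ := Nat.exists_eq_add_of_le' hb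
        simp only [show a + 2 - 1 = a + 1 by omega, show b + 2 - 1 = b + 1 by omega] at *
        linear_combination (y ^ (b + 1 + k)) * h₁ - ((a + 2 : ℕ) : B) * x ^ a * y ^ k * hxy
      rcases Nat.eq_zero_or_pos j with rfl | hj0
      · obtain ⟨k, rfl⟩ := Nat.exists_eq_add_of_le (show a + (a - 1) ≤ i by omega)
        obtain ⟨a, rfl⟩ := Nat.exists_eq_add_of_le' ha
        obtain ⟨b, rfl⟩ := Nat.exists_eq_add_of_le' hb
        simp only [show a + 2 - 1 = a + 1 by omega, show b + 2 - 1 = b + 1 by omega] at *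
        linear_combination (x ^ (a + 1 + k)) * h₂ - ((b + 2 : ℕ) : B) * y ^ b * x ^ k * hyx
      by_cases hja : b ≤ j
      · obtain ⟨k, rfl⟩ := Nat.exists_eq_add_of_le hja
        obtain ⟨l, rfl⟩ := Nat.exists_eq_add_of_le hi0
        linear_combination x ^ l * y ^ k * hxy
      · obtain ⟨k, rfl⟩ := Nat.exists_eq_add_of_le (show a ≤ i by omega)
        obtain ⟨l, rfl⟩ := Nat.exists_eq_add_of_le hj0
        linear_combination x ^ k * y ^ l * hyx
    · intro p _ q _
      unfold normalFormCoeff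
      split_ifs <;> first | rfl | (exfalso; omega)

end Relations

theorem MvPolynomial.monomial_one_fin_four {R : Type*} [CommSemiring R] (m : Fin 4 →₀ ℕ) :
    (monomial m 1 : MvPolynomial (Fin 4) R) =
      X 0 ^ m 0 * X 1 ^ m 1 * (X 2 ^ m 2 * X 3 ^ m 3) := by
  rw [monomial_eq, Finsupp.prod_fintype _ _ (by simp)]
  simp [Fin.prod_univ_four, mul_assoc]

theorem MvPolynomial.linearMap_ext_fin_four {R M : Type*} [CommSemiring R] [AddCommMonoid M]
    [Module R M] {f g : MvPolynomial (Fin 4) R →ₗ[R] M}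
    (h : ∀ i j k l, f (X 0 ^ i * X 1 ^ j * (X 2 ^ k * X 3 ^ l)) =
      g (X 0 ^ i * X 1 ^ j * (X 2 ^ k * X 3 ^ l))) : f = g := by
  refine (basisMonomials (Fin 4) R).ext fun m => ?_
  simp only [coe_basisMonomials, monomial_one_fin_four]
  exact h _ _ _ _

/-- The linear map sending a polynomial to the coefficients of its normal form modulo the partial
derivatives of `X 0 ^ a * X 1 + X 0 * X 1 ^ b + X 2 ^ c * X 3 + X 2 * X 3 ^ d`. -/
noncomputable def normalForm (a b c d : ℕ) :
    MvPolynomial (Fin 4) ℂ →ₗ[ℂ] ((Fin a × Fin b) × (Fin c × Fin d) → ℂ) :=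
  (basisMonomials (Fin 4) ℂ).constr ℂ fun m e =>
    normalFormCoeff a b (m 0) (m 1) e.1.1 e.1.2 * normalFormCoeff c d (m 2) (m 3) e.2.1 e.2.2

theorem normalForm_apply (a b c d i j k l : ℕ) (e : (Fin a × Fin b) × (Fin c × Fin d)) :
    normalForm a b c d (X 0 ^ i * X 1 ^ j * (X 2 ^ k * X 3 ^ l)) e =
      normalFormCoeff a b i j e.1.1 e.1.2 * normalFormCoeff c d k l e.2.1 e.2.2 := by
  have h := (basisMonomials (Fin 4) ℂ).constr_basis ℂ (fun m e =>
    normalFormCoeff a b (m 0) (m 1) e.1.1 e.1.2 * normalFormCoeff c d (m 2) (m 3) e.2.1 e.2.2 :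
      (Fin 4 →₀ ℕ) → (Fin a × Fin b) × (Fin c × Fin d) → ℂ)
    (Finsupp.equivFunOnFinite.symm ![i, j, k, l])
  simp only [coe_basisMonomials, monomial_one_fin_four] at h
  simpa [normalForm] using congrFun h e

theorem range_pderiv_type_VI (a b c d : ℕ) :
    (Set.range fun i : Fin 4 =>
          pderiv i (X 0 ^ a * X 1 + X 0 * X 1 ^ b + X 2 ^ c * X 3 + X 2 * X 3 ^ d :
            MvPolynomial (Fin 4) ℂ)) =
      {(a : MvPolynomial (Fin 4) ℂ) * X 0 ^ (a - 1) * X 1 + X 1 ^ b,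
        X 0 ^ a + (b : MvPolynomial (Fin 4) ℂ) * X 0 * X 1 ^ (b - 1),
        (c : MvPolynomial (Fin 4) ℂ) * X 2 ^ (c - 1) * X 3 + X 3 ^ d,
        X 2 ^ c + (d : MvPolynomial (Fin 4) ℂ) * X 2 * X 3 ^ (d - 1)} := by
  ext g
  simp only [Set.mem_range, Fin.exists_fin_succ, Set.mem_insert_iff, Set.mem_singleton_iff]
  simp [Derivation.leibniz, Derivation.leibniz_pow, pderiv_X, Pi.single_apply, eq_comm, mul_comm,
    mul_left_comm, add_comm]
  simp only [mul_assoc]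

theorem normalForm_mul_eq_zero {a b c d : ℕ} (ha : 2 ≤ a) (hb : 2 ≤ b) (hc : 2 ≤ c) (hd : 2 ≤ d)
    {r : MvPolynomial (Fin 4) ℂ}
    (hr : r ∈ ({(a : MvPolynomial (Fin 4) ℂ) * X 0 ^ (a - 1) * X 1 + X 1 ^ b,
        X 0 ^ a + (b : MvPolynomial (Fin 4) ℂ) * X 0 * X 1 ^ (b - 1),
        (c : MvPolynomial (Fin 4) ℂ) * X 2 ^ (c - 1) * X 3 + X 3 ^ d,
        X 2 ^ c + (d : MvPolynomial (Fin 4) ℂ) * X 2 * X 3 ^ (d - 1)} :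
          Set (MvPolynomial (Fin 4) ℂ)))
    (g : MvPolynomial (Fin 4) ℂ) : normalForm a b c d (g * r) = 0 := by
  have nsmul_eq (n : ℕ) (s : MvPolynomial (Fin 4) ℂ) :
      (n : MvPolynomial (Fin 4) ℂ) * s = (n : ℂ) • s := by
    rw [Algebra.smul_def, map_natCast]
  suffices h : normalForm a b c d ∘ₗ LinearMap.mulRight ℂ r = 0 from LinearMap.congr_fun h g
  refine linearMap_ext_fin_four fun i j k l => ?_
  ext e
  simp only [LinearMap.comp_apply, LinearMap.mulRight_apply, LinearMap.zero_apply, Pi.zero_apply]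
  rcases hr with rfl | rfl | rfl | rfl
  · rw [show (X 0 ^ i * X 1 ^ j * (X 2 ^ k * X 3 ^ l) *
        ((a : MvPolynomial (Fin 4) ℂ) * X 0 ^ (a - 1) * X 1 + X 1 ^ b) :
        MvPolynomial (Fin 4) ℂ) =
        (a : MvPolynomial (Fin 4) ℂ) * (X 0 ^ (i + (a - 1)) * X 1 ^ (j + 1) * (X 2 ^ k * X 3 ^ l)) +
          X 0 ^ i * X 1 ^ (j + b) * (X 2 ^ k * X 3 ^ l) by ring, nsmul_eq, map_add, map_smul]
    simp only [Pi.add_apply, Pi.smul_apply, normalForm_apply, smul_eq_mul]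
    linear_combination normalFormCoeff c d k l e.2.1 e.2.2 *
      normalFormCoeff_relation ha hb i j e.1.1.2 e.1.2.2
  · rw [show (X 0 ^ i * X 1 ^ j * (X 2 ^ k * X 3 ^ l) *
        (X 0 ^ a + (b : MvPolynomial (Fin 4) ℂ) * X 0 * X 1 ^ (b - 1)) :
        MvPolynomial (Fin 4) ℂ) =
        X 0 ^ (i + a) * X 1 ^ j * (X 2 ^ k * X 3 ^ l) +
          (b : MvPolynomial (Fin 4) ℂ) * (X 0 ^ (i + 1) * X 1 ^ (j + (b - 1)) * (X 2 ^ k * X 3 ^ l)) by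
          ring,
      nsmul_eq, map_add, map_smul]
    simp only [Pi.add_apply, Pi.smul_apply, normalForm_apply, smul_eq_mul]
    linear_combination normalFormCoeff c d k l e.2.1 e.2.2 *
      normalFormCoeff_relation' ha hb i j e.1.1.2 e.1.2.2
  · rw [show (X 0 ^ i * X 1 ^ j * (X 2 ^ k * X 3 ^ l) *
        ((c : MvPolynomial (Fin 4) ℂ) * X 2 ^ (c - 1) * X 3 + X 3 ^ d) :
        MvPolynomial (Fin 4) ℂ) =
        (c : MvPolynomial (Fin 4) ℂ) * (X 0 ^ i * X 1 ^ j * (X 2 ^ (k + (c - 1)) * X 3 ^ (l + 1))) +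
          X 0 ^ i * X 1 ^ j * (X 2 ^ k * X 3 ^ (l + d)) by ring, nsmul_eq, map_add, map_smul]
    simp only [Pi.add_apply, Pi.smul_apply, normalForm_apply, smul_eq_mul]
    linear_combination normalFormCoeff a b i j e.1.1 e.1.2 *
      normalFormCoeff_relation hc hd k l e.2.1.2 e.2.2.2
  · rw [show (X 0 ^ i * X 1 ^ j * (X 2 ^ k * X 3 ^ l) *
        (X 2 ^ c + (d : MvPolynomial (Fin 4) ℂ) * X 2 * X 3 ^ (d - 1)) :
        MvPolynomial (Fin 4) ℂ) =
        X 0 ^ i * X 1 ^ j * (X 2 ^ (k + c) * X 3 ^ l) +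
          (d : MvPolynomial (Fin 4) ℂ) * (X 0 ^ i * X 1 ^ j * (X 2 ^ (k + 1) * X 3 ^ (l + (d - 1)))) by
          ring,
      nsmul_eq, map_add, map_smul]
    simp only [Pi.add_apply, Pi.smul_apply, normalForm_apply, smul_eq_mul]
    linear_combination normalFormCoeff a b i j e.1.1 e.1.2 *
      normalFormCoeff_relation' hc hd k l e.2.1.2 e.2.2.2

theorem normalForm_basis (a b c d : ℕ) (e : (Fin a × Fin b) × (Fin c × Fin d)) :
    normalForm a b c d (X 0 ^ (e.1.1 : ℕ) * X 1 ^ (e.1.2 : ℕ) *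
      (X 2 ^ (e.2.1 : ℕ) * X 3 ^ (e.2.2 : ℕ))) = Pi.single e 1 := by
  obtain ⟨⟨p, q⟩, r, s⟩ := e
  ext ⟨⟨p', q'⟩, r', s'⟩
  rw [normalForm_apply]
  simp only [normalFormCoeff, Fin.is_lt, and_self, if_true, Pi.single_apply, Prod.mk.injEq,
    Fin.ext_iff, ← ite_and, mul_ite, mul_one, mul_zero]
  congr 1
  exact propext and_comm

/-- Milnor number formula for Type VI:  for `f = z_0^a z_1 + z_0 z_1^b + z_2^c z_3 + z_2 z_3^d`
with `a, b, c, d ≥ 2`, the complex dimension of the Milnor algebra equals `abcd`. -/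
theorem milnor_number_type_VI
    (a b c d : ℕ) (ha : 2 ≤ a) (hb : 2 ≤ b) (hc : 2 ≤ c) (hd : 2 ≤ d) :
    Module.finrank ℂ
      (MvPolynomial (Fin 4) ℂ ⧸
        Ideal.span (Set.range fun i : Fin 4 =>
          pderiv i (X 0 ^ a * X 1 + X 0 * X 1 ^ b + X 2 ^ c * X 3 + X 2 * X 3 ^ d :
            MvPolynomial (Fin 4) ℂ)))
      = a * b * c * d := by
  rw [range_pderiv_type_VI]
  set G : Set (MvPolynomial (Fin 4) ℂ) := {_, _, _, _} with hG
  let π := Ideal.Quotient.mkₐ ℂ (Ideal.span G)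
  have hπ {r : MvPolynomial (Fin 4) ℂ} (hr : r ∈ G) : π r = 0 :=
    Ideal.Quotient.eq_zero_iff_mem.2 (Ideal.subset_span hr)
  let S : ((Fin a × Fin b) × (Fin c × Fin d) → ℂ) →ₗ[ℂ] MvPolynomial (Fin 4) ℂ :=
    Fintype.linearCombination ℂ fun e => X 0 ^ (e.1.1 : ℕ) * X 1 ^ (e.1.2 : ℕ) *
      (X 2 ^ (e.2.1 : ℕ) * X 3 ^ (e.2.2 : ℕ))
  have hNS : normalForm a b c d ∘ₗ S = LinearMap.id := by
    refine (Pi.basisFun ℂ _).ext fun e => ?_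
    simp [S, Fintype.linearCombination_apply_single, normalForm_basis]
  have hSN : π.toLinearMap ∘ₗ S ∘ₗ normalForm a b c d = π.toLinearMap := by
    refine linearMap_ext_fin_four fun i j k l => ?_
    have h₁ := sum_normalFormCoeff_smul (x := π (X 0)) (y := π (X 1)) ha hb
      (.trans (by rw [map_add]; simp only [map_mul, map_pow, map_natCast]) <|
        hπ (r := (a : MvPolynomial (Fin 4) ℂ) * X 0 ^ (a - 1) * X 1 + X 1 ^ b) (by simp [hG]))
      (.trans (by rw [map_add]; simp only [map_mul, map_pow, map_natCast]) <|
        hπ (r := X 0 ^ a + (b : MvPolynomial (Fin 4) ℂ) * X 0 * X 1 ^ (b - 1)) (by simp [hG])) i j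
    have h₂ := sum_normalFormCoeff_smul (x := π (X 2)) (y := π (X 3)) hc hd
      (.trans (by rw [map_add]; simp only [map_mul, map_pow, map_natCast]) <|
        hπ (r := (c : MvPolynomial (Fin 4) ℂ) * X 2 ^ (c - 1) * X 3 + X 3 ^ d) (by simp [hG]))
      (.trans (by rw [map_add]; simp only [map_mul, map_pow, map_natCast]) <|
        hπ (r := X 2 ^ c + (d : MvPolynomial (Fin 4) ℂ) * X 2 * X 3 ^ (d - 1)) (by simp [hG])) k l
    simp only [LinearMap.comp_apply, AlgHom.toLinearMap_apply, S,
      Fintype.linearCombination_apply, map_sum, map_smul, normalForm_apply, map_mul, map_pow]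
    rw [← h₁, ← h₂, Fintype.sum_mul_sum, ← Fintype.sum_prod_type']
    simp only [smul_mul_smul_comm]
  have hker {r : MvPolynomial (Fin 4) ℂ} (hr : r ∈ Ideal.span G) : normalForm a b c d r = 0 := by
    suffices h : ∀ g, normalForm a b c d (g * r) = 0 by simpa using h 1
    induction hr using Submodule.span_induction with
    | mem r hr => exact normalForm_mul_eq_zero ha hb hc hd hr
    | zero => simp
    | add r s _ _ hr hs => intro g; rw [mul_add, map_add, hr, hs, add_zero]
    | smul t r _ hr => intro g; rw [smul_eq_mul, ← mul_assoc, hr]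
  let e := LinearEquiv.ofBijective (π.toLinearMap ∘ₗ S) ⟨by
      refine (injective_iff_map_eq_zero _).2 fun v hv => ?_
      have h := hker (Ideal.Quotient.eq_zero_iff_mem.1 hv)
      rwa [← LinearMap.comp_apply, hNS] at h, fun t => by
      obtain ⟨g, rfl⟩ := Ideal.Quotient.mk_surjective t
      exact ⟨normalForm a b c d g, LinearMap.congr_fun hSN g⟩⟩
  rw [← e.finrank_eq, Module.finrank_fintype_fun_eq_card]
  simp [mul_assoc]
end

section
/- Let a, b, c, d be integers ≥ 2 and let f = z_0^a + z_1^b + z_1 z_2^c + z_2 z_3^d ∈ ℂ[z_0,z_1,z_2,z_3] (Type VII of the classification). Then the Milnor number of f satisfies μ(f) = (a-1)(bc(d-1) + b - 1); that is, the complex dimension of ℂ[z_0,z_1,z_2,z_3]/(∂f/∂z_0, ∂f/∂z_1, ∂f/∂z_2, ∂f/∂z_3) equals (a-1)(bc(d-1)+b-1). -/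
open MvPolynomial

namespace TypeVII

/-- Exponents of the monomials forming a basis of the Milnor algebra of type VII. -/
def basisExponents (a b c d : ℕ) : Finset (ℕ × ℕ × ℕ × ℕ) :=
  Finset.range (a - 1) ×ˢ
    (Finset.range b ×ˢ Finset.range c ×ˢ Finset.range (d - 1) ∪
      Finset.range (b - 1) ×ˢ {0} ×ˢ {d - 1})

theorem mem_basisExponents {a b c d i j k l : ℕ} :
    (i, j, k, l) ∈ basisExponents a b c d ↔
      i < a - 1 ∧ ((j < b ∧ k < c ∧ l < d - 1) ∨ (j < b - 1 ∧ k = 0 ∧ l = d - 1)) := by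
  simp only [basisExponents, Finset.mem_product, Finset.mem_union, Finset.mem_range,
    Finset.mem_singleton]

theorem card_basisExponents {a b c d : ℕ} (hb : 1 ≤ b) :
    (basisExponents a b c d).card = (a - 1) * (b * c * (d - 1) + b - 1) := by
  rw [basisExponents, Finset.card_product, Finset.card_union_of_disjoint]
  · simp only [Finset.card_product, Finset.card_range, Finset.card_singleton]
    rw [Nat.add_sub_assoc hb]
    ring
  · rw [Finset.disjoint_left]
    rintro ⟨j, k, l⟩ h h'
    simp at h h'
    omega

/-- The exponent of `z_2` after eliminating `z_3 ^ d = -c z_1 z_2 ^ (c - 1)`. -/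
def zExp (c d k l : ℕ) : ℕ := k + (c - 1) * (l / d)

/-- The exponent of `z_1` after also eliminating `z_2 ^ c = -b z_1 ^ (b - 1)`. -/
def yExp (b c d j k l : ℕ) : ℕ := j + l / d + (b - 1) * (zExp c d k l / c)

/-- The exponents of the reduction of a monomial. -/
def redExp (b c d i j k l : ℕ) : ℕ × ℕ × ℕ × ℕ :=
  (i, yExp b c d j k l, zExp c d k l % c, l % d)

/-- The coefficient of the reduction of a monomial. -/
noncomputable def redCoeff (b c d k l : ℕ) : ℂ :=
  (-(c : ℂ)) ^ (l / d) * (-(b : ℂ)) ^ (zExp c d k l / c)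

/-- The normal form of the monomial `z_0 ^ i z_1 ^ j z_2 ^ k z_3 ^ l`. -/
noncomputable def normalForm (a b c d i j k l : ℕ) : (ℕ × ℕ × ℕ × ℕ) →₀ ℂ :=
  if redExp b c d i j k l ∈ basisExponents a b c d then
    Finsupp.single (redExp b c d i j k l) (redCoeff b c d k l) else 0

section Relations

variable {a b c d : ℕ}

theorem normalForm_add_left (i j k l : ℕ) : normalForm a b c d (i + (a - 1)) j k l = 0 := by
  rw [normalForm, if_neg]
  rw [redExp, mem_basisExponents]
  omega

theorem normalForm_add_w (hd : 0 < d) (i j k l : ℕ) :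
    normalForm a b c d i j k (l + d) =
      (-(c : ℂ)) • normalForm a b c d i (j + 1) (k + (c - 1)) l := by
  have hz : zExp c d k (l + d) = zExp c d (k + (c - 1)) l := by
    simp only [zExp, Nat.add_div_right _ hd]; ring
  have he : redExp b c d i j k (l + d) = redExp b c d i (j + 1) (k + (c - 1)) l := by
    simp only [redExp, yExp, hz, Nat.add_div_right _ hd, Nat.add_mod_right, Prod.mk.injEq,
      true_and, and_true]
    ring
  have hr : redCoeff b c d k (l + d) = -(c : ℂ) * redCoeff b c d (k + (c - 1)) l := by
    simp only [redCoeff, hz, Nat.add_div_right _ hd]; ring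
  simp only [normalForm, he, hr]
  split_ifs <;> simp

theorem normalForm_add_z (hc : 0 < c) (i j k l : ℕ) :
    normalForm a b c d i j (k + c) l =
      (-(b : ℂ)) • normalForm a b c d i (j + (b - 1)) k l := by
  have hz : zExp c d (k + c) l = zExp c d k l + c := by
    simp only [zExp]; ring
  have he : redExp b c d i j (k + c) l = redExp b c d i (j + (b - 1)) k l := by
    simp only [redExp, yExp, hz, Nat.add_div_right _ hc, Nat.add_mod_right, Prod.mk.injEq,
      true_and, and_true]
    ring
  have hr : redCoeff b c d (k + c) l = -(b : ℂ) * redCoeff b c d k l := by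
    simp only [redCoeff, hz, Nat.add_div_right _ hc]; ring
  simp only [normalForm, he, hr]
  split_ifs <;> simp

theorem normalForm_add_zw (hb : 0 < b) (hc : 0 < c) (hd : 0 < d) (i j k l : ℕ) :
    normalForm a b c d i j (k + 1) (l + (d - 1)) = 0 := by
  rcases Nat.eq_zero_or_pos (l % d) with h | h
  · rw [normalForm, if_neg]
    rw [redExp, mem_basisExponents]
    have hm : (l + (d - 1)) % d = d - 1 := by
      rw [Nat.add_mod, h, zero_add, Nat.mod_mod, Nat.mod_eq_of_lt (by omega)]
    rw [hm]
    rintro ⟨-, ⟨-, -, h1⟩ | ⟨h1, h2, -⟩⟩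
    · omega
    · have h3 : 0 < zExp c d (k + 1) (l + (d - 1)) / c :=
        Nat.div_pos (Nat.le_of_dvd (by unfold zExp; omega) (Nat.dvd_of_mod_eq_zero h2)) hc
      have h4 := Nat.le_mul_of_pos_right (b - 1) h3
      unfold yExp at h1
      exact absurd h1 (not_lt.2 (h4.trans (Nat.le_add_left _ _)))
  · obtain ⟨m, rfl⟩ : ∃ m, l = m + 1 := by
      refine ⟨l - 1, ?_⟩
      rcases l with _ | l
      · simp at h
      · rfl
    have e1 : m + 1 + (d - 1) = m + d := by omega
    have e2 : k + 1 + (c - 1) = k + c := by omega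
    rw [e1, normalForm_add_w hd, e2, normalForm_add_z hc, normalForm, if_neg]
    · simp
    · rw [redExp, mem_basisExponents]
      unfold yExp
      generalize zExp c d k m / c = K
      generalize m / d = q
      generalize (b - 1) * K = u
      omega

theorem normalForm_of_mem {i j k l : ℕ} (hc : 0 < c) (hd : 0 < d)
    (h : (i, j, k, l) ∈ basisExponents a b c d) :
    normalForm a b c d i j k l = Finsupp.single (i, j, k, l) 1 := by
  have h' := mem_basisExponents.1 h
  have hl : l < d := by omega
  have hk : k < c := by omega
  have hz : zExp c d k l = k := by simp [zExp, Nat.div_eq_of_lt hl]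
  have he : redExp b c d i j k l = (i, j, k, l) := by
    simp [redExp, yExp, hz, Nat.div_eq_of_lt hl, Nat.div_eq_of_lt hk, Nat.mod_eq_of_lt hl,
      Nat.mod_eq_of_lt hk]
  rw [normalForm, he, if_pos h, redCoeff, hz, Nat.div_eq_of_lt hl, Nat.div_eq_of_lt hk]
  simp

theorem normalForm_mem_supported (i j k l : ℕ) :
    normalForm a b c d i j k l ∈
      Finsupp.supported ℂ ℂ (basisExponents a b c d : Set (ℕ × ℕ × ℕ × ℕ)) := by
  unfold normalForm
  split_ifs with h
  · exact Finsupp.single_mem_supported _ _ h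
  · exact zero_mem _

end Relations

section Reduction

variable {A : Type*} [CommRing A] [Algebra ℂ A]

/-- The linear map sending exponents to the corresponding monomial in `x`, `y`, `z`, `w`. -/
noncomputable def realize (x y z w : A) : ((ℕ × ℕ × ℕ × ℕ) →₀ ℂ) →ₗ[ℂ] A :=
  Finsupp.lift A ℂ _ fun t => x ^ t.1 * y ^ t.2.1 * z ^ t.2.2.1 * w ^ t.2.2.2

theorem realize_single (x y z w : A) (i j k l : ℕ) (r : ℂ) :
    realize x y z w (Finsupp.single (i, j, k, l) r) =
      r • (x ^ i * y ^ j * z ^ k * w ^ l) := by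
  simp [realize]

theorem realize_normalForm {a b c d : ℕ} (hb : 0 < b) (hc : 0 < c) (hd : 0 < d) {x y z w : A}
    (hx : x ^ (a - 1) = 0) (hz : z ^ c = (-(b : ℂ)) • y ^ (b - 1))
    (hw : w ^ d = (-(c : ℂ)) • (y * z ^ (c - 1))) (hzw : z * w ^ (d - 1) = 0) (i j k l : ℕ) :
    realize x y z w (normalForm a b c d i j k l) = x ^ i * y ^ j * z ^ k * w ^ l := by
  have hb' : (-(b : ℂ)) ≠ 0 := by simpa using hb.ne'
  have hc' : (-(c : ℂ)) ≠ 0 := by simpa using hc.ne'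
  have hyw : y ^ (b - 1) * w ^ (d - 1) = 0 := by
    have h : (-(b : ℂ)) • (y ^ (b - 1) * w ^ (d - 1)) = 0 := by
      rw [← smul_mul_assoc, ← hz, ← Nat.sub_add_cancel hc, pow_succ, mul_assoc, hzw, mul_zero]
    exact (smul_eq_zero_iff_right hb').1 h
  have hyz : y * z ^ c = 0 := by
    have h : (-(c : ℂ)) • (y * z ^ c) = 0 := by
      have e1 : y * z ^ c = (y * z ^ (c - 1)) * z := by
        rw [mul_assoc, ← pow_succ, Nat.sub_add_cancel hc]
      have e2 : w ^ d = w ^ (d - 1) * w := by rw [← pow_succ, Nat.sub_add_cancel hd]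
      rw [e1, ← smul_mul_assoc, ← hw, e2]
      linear_combination w * hzw
    exact (smul_eq_zero_iff_right hc').1 h
  have hy : y ^ b = 0 := by
    have h : (-(b : ℂ)) • y ^ b = 0 := by
      rw [← Nat.sub_add_cancel hb, pow_succ, Nat.sub_add_cancel hb, ← smul_mul_assoc, ← hz,
        mul_comm, hyz]
    exact (smul_eq_zero_iff_right hb').1 h
  have key : x ^ i * y ^ j * z ^ k * w ^ l = redCoeff b c d k l •
      (x ^ i * y ^ yExp b c d j k l * z ^ (zExp c d k l % c) * w ^ (l % d)) := by
    have h1 : w ^ l = ((-(c : ℂ)) ^ (l / d)) •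
        (y ^ (l / d) * z ^ ((c - 1) * (l / d)) * w ^ (l % d)) := by
      conv_lhs => rw [← Nat.div_add_mod l d, pow_add, pow_mul, hw, smul_pow, mul_pow, ← pow_mul]
      rw [smul_mul_assoc]
    have h2 : z ^ zExp c d k l = ((-(b : ℂ)) ^ (zExp c d k l / c)) •
        (y ^ ((b - 1) * (zExp c d k l / c)) * z ^ (zExp c d k l % c)) := by
      conv_lhs =>
        rw [← Nat.div_add_mod (zExp c d k l) c, pow_add, pow_mul, hz, smul_pow, ← pow_mul]
      rw [smul_mul_assoc]
    calc x ^ i * y ^ j * z ^ k * w ^ l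
        = ((-(c : ℂ)) ^ (l / d)) •
            (x ^ i * y ^ (j + l / d) * z ^ zExp c d k l * w ^ (l % d)) := by
          rw [h1, mul_smul_comm, zExp, pow_add, pow_add]
          congr 1
          ring
      _ = _ := by
          rw [h2, redCoeff, yExp, pow_add _ (j + l / d), mul_smul, mul_smul_comm, smul_mul_assoc]
          congr 2
          ring
  rw [key, normalForm]
  split_ifs with h
  · rw [redExp, realize_single]
  · rw [map_zero]
    symm
    rw [redExp, mem_basisExponents] at h
    have hk := Nat.mod_lt (zExp c d k l) hc
    have hl := Nat.mod_lt l hd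
    generalize yExp b c d j k l = J at *
    generalize zExp c d k l % c = K at *
    generalize l % d = L at *
    convert smul_zero (redCoeff b c d k l)
    by_cases hi : a - 1 ≤ i
    · rw [pow_eq_zero_of_le hi hx]; ring
    by_cases hJ : b ≤ J
    · rw [pow_eq_zero_of_le hJ hy]; ring
    obtain rfl : L = d - 1 := by omega
    rcases Nat.eq_zero_or_pos K with rfl | hK
    · obtain ⟨m, rfl⟩ := Nat.exists_eq_add_of_le (show b - 1 ≤ J by omega)
      rw [pow_add]
      linear_combination x ^ i * y ^ m * z ^ 0 * hyw
    · obtain ⟨m, rfl⟩ := Nat.exists_eq_add_of_le (show 1 ≤ K by omega)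
      rw [pow_add]
      linear_combination x ^ i * y ^ J * z ^ m * hzw

end Reduction

theorem monomial_fin_four (m : Fin 4 →₀ ℕ) (r : ℂ) :
    monomial m r = r • (X 0 ^ m 0 * X 1 ^ m 1 * X 2 ^ m 2 * X 3 ^ m 3 :
      MvPolynomial (Fin 4) ℂ) := by
  rw [monomial_eq, Finsupp.prod_fintype _ _ (by simp), Fin.prod_univ_four, C_mul']

/-- The normal form of a polynomial modulo the Jacobian ideal. -/
noncomputable def reduce (a b c d : ℕ) :
    MvPolynomial (Fin 4) ℂ →ₗ[ℂ] ((ℕ × ℕ × ℕ × ℕ) →₀ ℂ) :=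
  (basisMonomials (Fin 4) ℂ).constr ℂ fun m => normalForm a b c d (m 0) (m 1) (m 2) (m 3)

theorem reduce_X_pow (a b c d i j k l : ℕ) :
    reduce a b c d (X 0 ^ i * X 1 ^ j * X 2 ^ k * X 3 ^ l) = normalForm a b c d i j k l := by
  have h := (basisMonomials (Fin 4) ℂ).constr_basis ℂ
    (fun m => normalForm a b c d (m 0) (m 1) (m 2) (m 3))
    (Finsupp.equivFunOnFinite.symm ![i, j, k, l])
  rw [coe_basisMonomials] at h
  beta_reduce at h
  rw [monomial_fin_four] at h
  simpa [reduce] using h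

theorem span_X_pow_induction {P : MvPolynomial (Fin 4) ℂ → Prop}
    (hmon : ∀ i j k l, P (X 0 ^ i * X 1 ^ j * X 2 ^ k * X 3 ^ l))
    (hadd : ∀ p q, P p → P q → P (p + q)) (hsmul : ∀ (r : ℂ) p, P p → P (r • p))
    (p : MvPolynomial (Fin 4) ℂ) : P p := by
  induction p using MvPolynomial.induction_on' with
  | monomial m r => rw [monomial_fin_four]; exact hsmul _ _ (hmon _ _ _ _)
  | add p q hp hq => exact hadd _ _ hp hq

theorem range_reduce {a b c d : ℕ} (hc : 0 < c) (hd : 0 < d) :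
    LinearMap.range (reduce a b c d) =
      Finsupp.supported ℂ ℂ (basisExponents a b c d : Set (ℕ × ℕ × ℕ × ℕ)) := by
  apply le_antisymm
  · rintro _ ⟨p, rfl⟩
    induction p using span_X_pow_induction with
    | hmon i j k l => rw [reduce_X_pow]; exact normalForm_mem_supported _ _ _ _
    | hadd p q hp hq => rw [map_add]; exact add_mem hp hq
    | hsmul r p hp => rw [map_smul]; exact Submodule.smul_mem _ _ hp
  · rw [Finsupp.supported_eq_span_single, Submodule.span_le]
    rintro _ ⟨⟨i, j, k, l⟩, h, rfl⟩
    exact ⟨_, (reduce_X_pow a b c d i j k l).trans (normalForm_of_mem hc hd h)⟩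

/-- The Jacobian ideal of the type VII polynomial. -/
noncomputable def jacobianIdeal (a b c d : ℕ) : Ideal (MvPolynomial (Fin 4) ℂ) :=
  Ideal.span (Set.range fun i : Fin 4 =>
    pderiv i (X 0 ^ a + X 1 ^ b + X 1 * X 2 ^ c + X 2 * X 3 ^ d : MvPolynomial (Fin 4) ℂ))

theorem jacobianIdeal_eq (a b c d : ℕ) : jacobianIdeal a b c d = Ideal.span
    {(a : ℂ) • X 0 ^ (a - 1), (b : ℂ) • X 1 ^ (b - 1) + X 2 ^ c,
      (c : ℂ) • (X 1 * X 2 ^ (c - 1)) + X 3 ^ d, (d : ℂ) • (X 2 * X 3 ^ (d - 1))} := by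
  rw [jacobianIdeal]
  congr 1
  ext p
  simp only [Set.mem_range, Fin.exists_fin_succ, Set.mem_insert_iff, Set.mem_singleton_iff]
  simp [Derivation.leibniz, Derivation.leibniz_pow, pderiv_X, Pi.single_apply, smul_eq_C_mul]
  simp only [eq_comm (b := p), mul_left_comm]

section MonomialMul

variable {A : Type*} [CommRing A] (x y z w : A) (i j k l m : ℕ)

theorem monomial_mul_x :
    x ^ i * y ^ j * z ^ k * w ^ l * x ^ m = x ^ (i + m) * y ^ j * z ^ k * w ^ l := by
  ring

theorem monomial_mul_y :
    x ^ i * y ^ j * z ^ k * w ^ l * y ^ m = x ^ i * y ^ (j + m) * z ^ k * w ^ l := by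
  ring

theorem monomial_mul_z :
    x ^ i * y ^ j * z ^ k * w ^ l * z ^ m = x ^ i * y ^ j * z ^ (k + m) * w ^ l := by
  ring

theorem monomial_mul_w :
    x ^ i * y ^ j * z ^ k * w ^ l * w ^ m = x ^ i * y ^ j * z ^ k * w ^ (l + m) := by
  ring

theorem monomial_mul_yz :
    x ^ i * y ^ j * z ^ k * w ^ l * (y * z ^ m) =
      x ^ i * y ^ (j + 1) * z ^ (k + m) * w ^ l := by
  ring

theorem monomial_mul_zw :
    x ^ i * y ^ j * z ^ k * w ^ l * (z * w ^ m) =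
      x ^ i * y ^ j * z ^ (k + 1) * w ^ (l + m) := by
  ring

end MonomialMul

theorem jacobianIdeal_le_ker {a b c d : ℕ} (hb : 0 < b) (hc : 0 < c) (hd : 0 < d)
    {g : MvPolynomial (Fin 4) ℂ} (hg : g ∈ jacobianIdeal a b c d) :
    reduce a b c d g = 0 := by
  suffices h : ∀ p, reduce a b c d (p * g) = 0 by simpa using h 1
  rw [jacobianIdeal_eq] at hg
  induction hg using Submodule.span_induction with
  | zero => simp
  | add p q _ _ hp hq => intro r; rw [mul_add, map_add, hp, hq, add_zero]
  | smul s p _ hp => intro r; rw [smul_eq_mul, ← mul_assoc]; exact hp _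
  | mem g hg =>
    intro p
    induction p using span_X_pow_induction with
    | hadd p q hp hq => rw [add_mul, map_add, hp, hq, add_zero]
    | hsmul r p hp => rw [smul_mul_assoc, map_smul, hp, smul_zero]
    | hmon i j k l =>
      simp only [Set.mem_insert_iff, Set.mem_singleton_iff] at hg
      rcases hg with rfl | rfl | rfl | rfl
      · rw [mul_smul_comm, monomial_mul_x, map_smul, reduce_X_pow, normalForm_add_left,
          smul_zero]
      · rw [mul_add, mul_smul_comm, monomial_mul_y, monomial_mul_z, map_add, map_smul,
          reduce_X_pow, reduce_X_pow, normalForm_add_z hc, neg_smul, add_neg_cancel]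
      · rw [mul_add, mul_smul_comm, monomial_mul_yz, monomial_mul_w, map_add, map_smul,
          reduce_X_pow, reduce_X_pow, normalForm_add_w hd, neg_smul, add_neg_cancel]
      · rw [mul_smul_comm, monomial_mul_zw, map_smul, reduce_X_pow,
          normalForm_add_zw hb hc hd, smul_zero]

theorem realize_reduce {a b c d : ℕ} (ha : 0 < a) (hb : 0 < b) (hc : 0 < c) (hd : 0 < d)
    (p : MvPolynomial (Fin 4) ℂ) :
    realize (Ideal.Quotient.mkₐ ℂ (jacobianIdeal a b c d) (X 0))
        (Ideal.Quotient.mkₐ ℂ (jacobianIdeal a b c d) (X 1))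
        (Ideal.Quotient.mkₐ ℂ (jacobianIdeal a b c d) (X 2))
        (Ideal.Quotient.mkₐ ℂ (jacobianIdeal a b c d) (X 3)) (reduce a b c d p) =
      Ideal.Quotient.mkₐ ℂ (jacobianIdeal a b c d) p := by
  have hker : ∀ g ∈ ({(a : ℂ) • X 0 ^ (a - 1), (b : ℂ) • X 1 ^ (b - 1) + X 2 ^ c,
      (c : ℂ) • (X 1 * X 2 ^ (c - 1)) + X 3 ^ d, (d : ℂ) • (X 2 * X 3 ^ (d - 1))} :
        Set (MvPolynomial (Fin 4) ℂ)), Ideal.Quotient.mkₐ ℂ (jacobianIdeal a b c d) g = 0 := by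
    intro g hg
    rw [Ideal.Quotient.mkₐ_eq_mk, Ideal.Quotient.eq_zero_iff_mem, jacobianIdeal_eq]
    exact Ideal.subset_span hg
  have ha' : (a : ℂ) ≠ 0 := by exact_mod_cast ha.ne'
  have hd' : (d : ℂ) ≠ 0 := by exact_mod_cast hd.ne'
  simp only [Set.mem_insert_iff, Set.mem_singleton_iff, forall_eq_or_imp, forall_eq, map_add,
    map_smul, map_mul, map_pow, smul_eq_zero_iff_right ha', smul_eq_zero_iff_right hd'] at hker
  obtain ⟨hx, hz, hw, hzw⟩ := hker
  induction p using span_X_pow_induction with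
  | hadd p q hp hq => rw [map_add, map_add, hp, hq, map_add]
  | hsmul r p hp => rw [map_smul, map_smul, hp, map_smul]
  | hmon i j k l =>
    rw [reduce_X_pow, realize_normalForm hb hc hd hx _ _ hzw]
    · simp only [map_mul, map_pow]
    · rw [neg_smul]; exact eq_neg_of_add_eq_zero_right hz
    · rw [neg_smul]; exact eq_neg_of_add_eq_zero_right hw

theorem ker_reduce {a b c d : ℕ} (ha : 0 < a) (hb : 0 < b) (hc : 0 < c) (hd : 0 < d) :
    LinearMap.ker (reduce a b c d) = (jacobianIdeal a b c d).restrictScalars ℂ := by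
  ext p
  rw [LinearMap.mem_ker, Submodule.restrictScalars_mem]
  refine ⟨fun h => ?_, jacobianIdeal_le_ker hb hc hd⟩
  rw [← Ideal.Quotient.eq_zero_iff_mem, ← Ideal.Quotient.mkₐ_eq_mk ℂ,
    ← realize_reduce ha hb hc hd, h, map_zero]

end TypeVII

open TypeVII in
/-- Milnor number formula for Type VII:  for `f = z_0^a + z_1^b + z_1 z_2^c + z_2 z_3^d`
with `a, b, c, d ≥ 2`, the complex dimension of the Milnor algebra equals
`(a-1)(bc(d-1)+b-1)`. -/
theorem milnor_number_type_VII
    (a b c d : ℕ) (ha : 2 ≤ a) (hb : 2 ≤ b) (hc : 2 ≤ c) (hd : 2 ≤ d) :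
    Module.finrank ℂ
      (MvPolynomial (Fin 4) ℂ ⧸
        Ideal.span (Set.range fun i : Fin 4 =>
          pderiv i (X 0 ^ a + X 1 ^ b + X 1 * X 2 ^ c + X 2 * X 3 ^ d :
            MvPolynomial (Fin 4) ℂ)))
      = (a - 1) * (b * c * (d - 1) + b - 1) := by
  change Module.finrank ℂ (MvPolynomial (Fin 4) ℂ ⧸ jacobianIdeal a b c d) = _
  have e := (Submodule.Quotient.restrictScalarsEquiv ℂ (jacobianIdeal a b c d)).symm ≪≫ₗ
    Submodule.quotEquivOfEq _ _
      (ker_reduce (by omega : 0 < a) (by omega : 0 < b) (by omega : 0 < c)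
        (by omega : 0 < d)).symm ≪≫ₗ
    (reduce a b c d).quotKerEquivRange ≪≫ₗ
    LinearEquiv.ofEq _ _ (range_reduce (by omega) (by omega)) ≪≫ₗ
    Finsupp.supportedEquivFinsupp _
  rw [e.finrank_eq, Module.finrank_finsupp_self, ← Nat.card_eq_fintype_card, Nat.card_coe_set_eq, Set.ncard_coe_finset,
    card_basisExponents (by omega)]
end
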